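/- arXiv:1306.4628 — 2 statements merged into one kernel-verified Lean document; each statement's English description precedes it below -/
import Mathlib

section
/- For all integers n ≥ 2 and k ≥ 2, the number of set partitions of {1,…,n} of genus 1 having exactly k blocks equals the number of permutations of {1,…,n−1} of genus 1 having exactly k−1 cycles. (Yip's conjecture.) -/
/-- The setoid on `Fin n` whose equivalence classes are the cycles (orbits) of the
permutation `α`. -/
def cycleSetoid {n : ℕ} (α : Equiv.Perm (Fin n)) : Setoid (Fin n) :=
  ⟨α.SameCycle,
    ⟨fun x => Equiv.Perm.SameCycle.refl α x, fun h => h.symm, fun h h' => h.trans h'⟩⟩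

/-- `zPerm α` is the number of cycles of `α`, i.e. the number of orbits of `⟨α⟩` acting
on `Fin n` (fixed points counting as cycles). -/
noncomputable def zPerm {n : ℕ} (α : Equiv.Perm (Fin n)) : ℕ :=
  Nat.card (Quotient (cycleSetoid α))

/-- `α` has genus one, i.e. `z(α) + z(α⁻¹ ∘ ζₙ) = n - 1` (written additively).
Here `finRotate n` plays the role of the cycle `ζₙ = (1, 2, …, n)`. -/
def IsGenusOne {n : ℕ} (α : Equiv.Perm (Fin n)) : Prop :=
  zPerm α + zPerm (α⁻¹ * finRotate n) + 2 = n + 1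

/-- `i` is a back point of `α`: `α i < i` and `α i` is not the smallest element of the
cycle (orbit) of `α` containing `i`. -/
def IsBackPoint {n : ℕ} (α : Equiv.Perm (Fin n)) (i : Fin n) : Prop :=
  α i < i ∧ ∃ j : Fin n, α.SameCycle i j ∧ j < α i

/-- The number of back points of `α`. -/
noncomputable def backPointCount {n : ℕ} (α : Equiv.Perm (Fin n)) : ℕ :=
  Nat.card {i : Fin n // IsBackPoint α i}

/-- `α` is the permutation associated with a set partition (each block of the partition
is a cycle of `α`, traversed in increasing order); equivalently, `α` has no back point. -/
def IsPartitionPerm {n : ℕ} (α : Equiv.Perm (Fin n)) : Prop :=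
  ∀ i : Fin n, ¬ IsBackPoint α i


section GenusOne

open Equiv Finset

section PermOrbits

variable {X : Type*}

theorem Equiv.Perm.SameCycle.rel_of_equivalence {σ : Perm X} {r : X → X → Prop}
    (hr : Equivalence r) (h : ∀ x, r x (σ x)) {x y : X} (hxy : σ.SameCycle x y) : r x y := by
  obtain ⟨i, rfl⟩ := hxy
  induction i with
  | zero => exact hr.refl x
  | succ i ih =>
    rw [add_comm, zpow_add, zpow_one, Perm.mul_apply]
    exact hr.trans ih (h _)
  | pred i ih =>
    have := h ((σ ^ (-(i : ℤ) - 1)) x)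
    rw [← Perm.mul_apply, ← zpow_one_add, add_sub_cancel] at this
    exact hr.trans ih (hr.symm this)

/-- The number of steps needed to reach `y` from `a` by iterating `σ`. -/
noncomputable def hitTime (σ : Perm X) (a y : X) : ℕ :=
  sInf {s : ℕ | (σ ^ s) a = y}

theorem pow_hitTime [Finite X] {σ : Perm X} {a y : X} (h : σ.SameCycle a y) :
    (σ ^ hitTime σ a y) a = y := by
  obtain ⟨s, hs⟩ := h.exists_nat_pow_eq
  exact Nat.sInf_mem (s := {s : ℕ | (σ ^ s) a = y}) ⟨s, hs⟩

theorem hitTime_le {σ : Perm X} {a y : X} {s : ℕ} (h : (σ ^ s) a = y) :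
    hitTime σ a y ≤ s :=
  Nat.sInf_le h

theorem hitTime_inj [Finite X] {σ : Perm X} {a y y' : X} (h : σ.SameCycle a y)
    (h' : σ.SameCycle a y') (e : hitTime σ a y = hitTime σ a y') : y = y' := by
  rw [← pow_hitTime h, ← pow_hitTime h', e]

variable [DecidableEq X]

theorem sameCycle_swap_mul_self [Finite X] {σ : Perm X} {a b : X} (h : ¬ σ.SameCycle a b) :
    (swap a b * σ).SameCycle b a := by
  obtain ⟨p, hp, hpb⟩ : ∃ p : ℕ, 0 < p ∧ (σ ^ p) b = b :=
    ⟨orderOf σ, orderOf_pos σ, by rw [pow_orderOf_eq_one]; rfl⟩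
  classical
  have hex : ∃ p : ℕ, 0 < p ∧ (σ ^ p) b = b := ⟨p, hp, hpb⟩
  obtain ⟨hq, hqb⟩ := Nat.find_spec hex
  have key : ∀ s < Nat.find hex, ((swap a b * σ) ^ s) b = (σ ^ s) b := by
    intro s hs
    induction s with
    | zero => rfl
    | succ s ih =>
      rw [pow_succ', Perm.mul_apply, ih (by omega), Perm.mul_apply, ← Perm.mul_apply σ,
        ← pow_succ']
      refine swap_apply_of_ne_of_ne ?_ ?_
      · exact fun h' => h (Perm.SameCycle.symm ⟨(s + 1 : ℕ), by rw [zpow_natCast]; exact h'⟩)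
      · exact fun h' => Nat.find_min hex hs ⟨by omega, h'⟩
  refine ⟨(Nat.find hex : ℕ), ?_⟩
  obtain ⟨q, hq'⟩ : ∃ q, Nat.find hex = q + 1 := ⟨Nat.find hex - 1, by omega⟩
  rw [zpow_natCast, hq', pow_succ', Perm.mul_apply, key q (by omega), Perm.mul_apply,
    ← Perm.mul_apply σ, ← pow_succ', ← hq', hqb, swap_apply_right]

theorem sameCycle_swap_mul_iff [Finite X] {σ : Perm X} {a b : X} (h : ¬ σ.SameCycle a b) (x y : X) :
    (swap a b * σ).SameCycle x y ↔ σ.SameCycle x y ∨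
      (σ.SameCycle a x ∨ σ.SameCycle b x) ∧ (σ.SameCycle a y ∨ σ.SameCycle b y) := by
  have hba := sameCycle_swap_mul_self h
  have h1 : ∀ {x y}, σ.SameCycle x y → (swap a b * σ).SameCycle x y := by
    refine fun hxy => hxy.rel_of_equivalence (r := (swap a b * σ).SameCycle)
      (Perm.SameCycle.equivalence _) fun x => ?_
    have h2 : σ x = swap a b ((swap a b * σ) x) := by simp
    have h3 : (swap a b * σ).SameCycle x ((swap a b * σ) x) := ⟨1, by simp⟩
    rw [h2]
    refine h3.trans ?_
    generalize (swap a b * σ) x = u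
    rcases eq_or_ne u a with rfl | hua
    · rw [swap_apply_left]; exact hba.symm
    rcases eq_or_ne u b with rfl | hub
    · rw [swap_apply_right]; exact hba
    · rw [swap_apply_of_ne_of_ne hua hub]
  constructor
  · refine fun hxy => hxy.rel_of_equivalence (r := fun x y => σ.SameCycle x y ∨
      (σ.SameCycle a x ∨ σ.SameCycle b x) ∧ (σ.SameCycle a y ∨ σ.SameCycle b y))
      ⟨fun x => Or.inl (Perm.SameCycle.refl _ _), ?_, ?_⟩ fun x => ?_
    · rintro x y (h | h)
      exacts [Or.inl h.symm, Or.inr h.symm]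
    · rintro x y z (h | h) (h' | h')
      · exact Or.inl (h.trans h')
      · exact Or.inr ⟨h'.1.imp (fun u => u.trans h.symm) (fun u => u.trans h.symm), h'.2⟩
      · exact Or.inr ⟨h.1, h.2.imp (fun u => u.trans h') (fun u => u.trans h')⟩
      · exact Or.inr ⟨h.1, h'.2⟩
    · have hx : σ.SameCycle x (σ x) := ⟨1, by simp⟩
      rw [Perm.mul_apply]
      rcases eq_or_ne (σ x) a with hua | hua
      · rw [hua, swap_apply_left]
        exact Or.inr ⟨Or.inl (hua ▸ hx.symm), Or.inr (Perm.SameCycle.refl _ _)⟩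
      rcases eq_or_ne (σ x) b with hub | hub
      · rw [hub, swap_apply_right]
        exact Or.inr ⟨Or.inr (hub ▸ hx.symm), Or.inl (Perm.SameCycle.refl _ _)⟩
      · rw [swap_apply_of_ne_of_ne hua hub]
        exact Or.inl hx
  · rintro (h | ⟨h | h, h' | h'⟩)
    · exact h1 h
    · exact h1 (h.symm.trans h')
    · exact (h1 h.symm).trans (hba.symm.trans (h1 h'))
    · exact (h1 h.symm).trans (hba.trans (h1 h'))
    · exact h1 (h.symm.trans h')

/-- Multiplying by a transposition of two points of a cycle cuts off the initial part of it. -/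
theorem sameCycle_swap_mul_left_iff [Finite X] {σ : Perm X} {a b : X} (h : σ.SameCycle a b)
    (hab : a ≠ b) (y : X) : (swap a b * σ).SameCycle a y ↔
      σ.SameCycle a y ∧ hitTime σ a y < hitTime σ a b := by
  set t := hitTime σ a b with ht
  have htb : (σ ^ t) a = b := pow_hitTime h
  have ht0 : t ≠ 0 := by
    intro h0
    rw [h0] at htb
    exact hab htb
  have hlow : ∀ s, s + 1 < t → (σ ^ (s + 1)) a ≠ a := by
    intro s hs h'
    have h2 : (σ ^ (t - (s + 1))) a = b := by
      have h3 : t = (t - (s + 1)) + (s + 1) := by omega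
      rw [h3, pow_add, Perm.mul_apply, h'] at htb
      exact htb
    have := hitTime_le h2
    omega
  have step : ∀ s, s + 1 < t → (swap a b * σ) ((σ ^ s) a) = (σ ^ (s + 1)) a := by
    intro s hs
    rw [Perm.mul_apply, ← Perm.mul_apply σ, ← pow_succ']
    refine swap_apply_of_ne_of_ne (hlow s hs) fun h' => ?_
    have := hitTime_le h'
    omega
  have hpow : ∀ s < t, ((swap a b * σ) ^ s) a = (σ ^ s) a := by
    intro s hs
    induction s with
    | zero => rfl
    | succ s ih => rw [pow_succ', Perm.mul_apply, ih (by omega), step s hs]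
  constructor
  · intro hy
    obtain ⟨m, rfl⟩ := hy.exists_nat_pow_eq
    clear hy
    have : ∃ s < t, ((swap a b * σ) ^ m) a = (σ ^ s) a := by
      induction m with
      | zero => exact ⟨0, by omega, rfl⟩
      | succ m ih =>
        obtain ⟨s, hs, e⟩ := ih
        rw [pow_succ', Perm.mul_apply, e]
        rcases Nat.lt_or_ge (s + 1) t with h1 | h1
        · exact ⟨s + 1, h1, step s h1⟩
        · refine ⟨0, by omega, ?_⟩
          have h2 : s + 1 = t := by omega
          rw [Perm.mul_apply, ← Perm.mul_apply σ, ← pow_succ', h2, htb, swap_apply_right]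
          rfl
    obtain ⟨s, hs, e⟩ := this
    rw [e]
    exact ⟨⟨s, by simp⟩, (hitTime_le rfl).trans_lt hs⟩
  · rintro ⟨hy, hlt⟩
    exact ⟨(hitTime σ a y : ℕ), by rw [zpow_natCast, hpow _ hlt, pow_hitTime hy]⟩

theorem not_sameCycle_swap_mul [Finite X] {σ : Perm X} {a b : X} (h : σ.SameCycle a b)
    (hab : a ≠ b) : ¬ (swap a b * σ).SameCycle a b := by
  rw [sameCycle_swap_mul_left_iff h hab]
  exact fun h' => lt_irrefl _ h'.2

theorem sameCycle_iff_swap_mul [Finite X] {σ : Perm X} {a b : X} (h : σ.SameCycle a b)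
    (hab : a ≠ b) (x y : X) : σ.SameCycle x y ↔ (swap a b * σ).SameCycle x y ∨
      ((swap a b * σ).SameCycle a x ∨ (swap a b * σ).SameCycle b x) ∧
      ((swap a b * σ).SameCycle a y ∨ (swap a b * σ).SameCycle b y) := by
  have := sameCycle_swap_mul_iff (not_sameCycle_swap_mul h hab) x y
  rwa [swap_mul_self_mul] at this

end PermOrbits

theorem zPerm_swap_mul {n : ℕ} {σ : Perm (Fin n)} {a b : Fin n} (h : ¬ σ.SameCycle a b) :
    zPerm (swap a b * σ) + 1 = zPerm σ := by
  classical
  have hle : ∀ x y, σ.SameCycle x y → (swap a b * σ).SameCycle x y := fun x y hxy =>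
    (sameCycle_swap_mul_iff h x y).2 (Or.inl hxy)
  let B : Quotient (cycleSetoid σ) := Quotient.mk _ b
  let f : {q : Quotient (cycleSetoid σ) // q ≠ B} → Quotient (cycleSetoid (swap a b * σ)) :=
    fun q => Quotient.map' (s₁ := cycleSetoid σ) (s₂ := cycleSetoid (swap a b * σ)) id hle q.1
  have hf : Function.Bijective f := by
    constructor
    · rintro ⟨q, hq⟩ ⟨q', hq'⟩ e
      induction q using Quotient.inductionOn with | _ x
      induction q' using Quotient.inductionOn with | _ y
      have hx : ¬ σ.SameCycle b x := fun hx => hq (Quotient.sound (Perm.SameCycle.symm hx))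
      have hy : ¬ σ.SameCycle b y := fun hx => hq' (Quotient.sound (Perm.SameCycle.symm hx))
      have exy : (swap a b * σ).SameCycle x y := Quotient.exact e
      refine Subtype.ext (Quotient.sound ?_)
      rcases (sameCycle_swap_mul_iff h x y).1 exy with h1 | ⟨h1 | h1, h2 | h2⟩
      · exact h1
      · exact h1.symm.trans h2
      · exact absurd h2 hy
      · exact absurd h1 hx
      · exact absurd h1 hx
    · intro q
      induction q using Quotient.inductionOn with | _ x
      by_cases hx : σ.SameCycle x b
      · refine ⟨⟨Quotient.mk _ a, fun e => h (Quotient.exact e)⟩, Quotient.sound ?_⟩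
        exact (sameCycle_swap_mul_self h).symm.trans (hle _ _ hx.symm)
      · exact ⟨⟨Quotient.mk _ x, fun e => hx (Quotient.exact e)⟩, rfl⟩
  have h1 : zPerm (swap a b * σ) = Nat.card {q : Quotient (cycleSetoid σ) // q ≠ B} :=
    (Nat.card_eq_of_bijective f hf).symm
  have : Fintype (Quotient (cycleSetoid σ)) := Fintype.ofFinite _
  have h2 : Fintype.card {q : Quotient (cycleSetoid σ) // q ≠ B} =
      Fintype.card (Quotient (cycleSetoid σ)) - 1 := by
    rw [Fintype.card_subtype_compl, Fintype.card_subtype_eq]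
  have h3 : 0 < Fintype.card (Quotient (cycleSetoid σ)) := Fintype.card_pos_iff.2 ⟨B⟩
  rw [h1, zPerm, Nat.card_eq_fintype_card, Nat.card_eq_fintype_card, h2]
  omega

theorem zPerm_swap_mul_of_sameCycle {n : ℕ} {σ : Perm (Fin n)} {a b : Fin n}
    (h : σ.SameCycle a b) (hab : a ≠ b) : zPerm (swap a b * σ) = zPerm σ + 1 := by
  have := zPerm_swap_mul (not_sameCycle_swap_mul h hab)
  rw [swap_mul_self_mul] at this
  exact this.symm

section Insertion

variable {n : ℕ}

/-- Extend a permutation by a new last fixed point. -/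
def extLast (α : Perm (Fin n)) : Perm (Fin (n + 1)) :=
  finSuccEquivLast.symm.permCongr (optionCongr α)

@[simp]
theorem extLast_castSucc (α : Perm (Fin n)) (i : Fin n) :
    extLast α i.castSucc = (α i).castSucc := by
  simp [extLast, Equiv.permCongr_apply]

@[simp]
theorem extLast_last (α : Perm (Fin n)) : extLast α (Fin.last n) = Fin.last n := by
  simp [extLast, Equiv.permCongr_apply]

theorem extLast_injective : Function.Injective (extLast (n := n)) := by
  intro α β h
  ext i : 1
  have := congrArg (fun σ : Perm (Fin (n + 1)) => σ i.castSucc) h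
  simpa using this

/-- Insert a new last point, either as a fixed point or right after a given point in its cycle. -/
def insertLast (α : Perm (Fin n)) : Option (Fin n) → Perm (Fin (n + 1))
  | none => extLast α
  | some i => extLast α * swap (Fin.last n) i.castSucc

theorem insertLast_bijective :
    Function.Bijective fun p : Perm (Fin n) × Option (Fin n) => insertLast p.1 p.2 := by
  rw [Fintype.bijective_iff_injective_and_card]
  constructor
  · have h1 : ∀ (α : Perm (Fin n)) (o : Option (Fin n)),
        insertLast α o (finSuccEquivLast.symm o) = Fin.last n := by
      rintro α (_ | i) <;> simp [insertLast]
    rintro ⟨α, o⟩ ⟨β, o'⟩ h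
    dsimp only at h
    have h2 := h1 α o
    rw [h, ← h1 β o'] at h2
    have h3 : o = o' := finSuccEquivLast.symm.injective ((insertLast β o').injective h2)
    subst h3
    cases o with
    | none => rw [extLast_injective h]
    | some i => rw [extLast_injective (mul_right_cancel h)]
  · simp [Fintype.card_perm, Nat.factorial_succ, mul_comm]

theorem sum_perm_succ {M : Type*} [AddCommMonoid M] (F : Perm (Fin (n + 1)) → M) :
    ∑ β, F β = ∑ α : Perm (Fin n),
      (F (insertLast α none) + ∑ i, F (insertLast α (some i))) := by
  rw [← insertLast_bijective.sum_comp F, Fintype.sum_prod_type]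
  simp only [Fintype.sum_option]

theorem extLast_inv (α : Perm (Fin n)) : (extLast α)⁻¹ = extLast α⁻¹ := by
  rw [inv_eq_iff_mul_eq_one]
  ext i : 1
  induction i using Fin.lastCases <;> simp

theorem sameCycle_extLast_castSucc {α : Perm (Fin n)} {i j : Fin n} :
    (extLast α).SameCycle i.castSucc j.castSucc ↔ α.SameCycle i j := by
  have hpow : ∀ m : ℕ, ((extLast α) ^ m) i.castSucc = ((α ^ m) i).castSucc := by
    intro m
    induction m with
    | zero => rfl
    | succ m ih => rw [pow_succ', pow_succ', Perm.mul_apply, Perm.mul_apply, ih, extLast_castSucc]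
  constructor
  · intro h
    obtain ⟨m, hm⟩ := h.exists_nat_pow_eq
    rw [hpow] at hm
    exact ⟨m, by simpa using hm⟩
  · intro h
    obtain ⟨m, hm⟩ := h.exists_nat_pow_eq
    exact ⟨m, by rw [zpow_natCast, hpow, hm]⟩

theorem sameCycle_extLast_last {α : Perm (Fin n)} {x : Fin (n + 1)} :
    (extLast α).SameCycle (Fin.last n) x ↔ x = Fin.last n := by
  constructor
  · intro h
    obtain ⟨m, hm⟩ := h.exists_nat_pow_eq
    rw [← hm]
    exact Function.IsFixedPt.perm_pow (extLast_last α) m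
  · rintro rfl
    exact Perm.SameCycle.refl _ _

theorem zPerm_inv (α : Perm (Fin n)) : zPerm α⁻¹ = zPerm α := by
  have : cycleSetoid α⁻¹ = cycleSetoid α := Setoid.ext fun x y => Perm.sameCycle_inv
  rw [zPerm, zPerm, this]

theorem zPerm_extLast (α : Perm (Fin n)) : zPerm (extLast α) = zPerm α + 1 := by
  have h : ∀ i : Fin n, ¬ (extLast α).SameCycle i.castSucc (Fin.last n) := fun i h =>
    (Fin.castSucc_lt_last i).ne (sameCycle_extLast_last.1 h.symm)
  let f : Option (Quotient (cycleSetoid α)) → Quotient (cycleSetoid (extLast α)) := fun o =>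
    o.elim (Quotient.mk _ (Fin.last n)) (Quotient.map' (s₁ := cycleSetoid α)
      (s₂ := cycleSetoid (extLast α)) Fin.castSucc fun _ _ => sameCycle_extLast_castSucc.2)
  have hf : Function.Bijective f := by
    constructor
    · rintro (_ | q) (_ | q') e
      · rfl
      · induction q' using Quotient.inductionOn with | _ x
        exact absurd (Perm.SameCycle.symm (Quotient.exact e)) (h x)
      · induction q using Quotient.inductionOn with | _ x
        exact absurd (Quotient.exact e) (h x)
      · induction q using Quotient.inductionOn with | _ x
        induction q' using Quotient.inductionOn with | _ y
        exact congrArg some (Quotient.sound (sameCycle_extLast_castSucc.1 (Quotient.exact e)))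
    · intro q
      induction q using Quotient.inductionOn with | _ x
      induction x using Fin.lastCases with
      | last => exact ⟨none, rfl⟩
      | cast x => exact ⟨some (Quotient.mk _ x), rfl⟩
  rw [zPerm, ← Nat.card_eq_of_bijective f hf, Finite.card_option, zPerm]

theorem zPerm_mul_swap {σ : Perm (Fin n)} {a b : Fin n} (h : ¬ σ.SameCycle a b) :
    zPerm (σ * swap a b) + 1 = zPerm σ := by
  rw [← zPerm_inv (σ * swap a b), mul_inv_rev, swap_inv, zPerm_swap_mul, zPerm_inv]
  rwa [Perm.sameCycle_inv]

theorem zPerm_insertLast_some (α : Perm (Fin n)) (i : Fin n) :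
    zPerm (insertLast α (some i)) = zPerm α := by
  have : zPerm (insertLast α (some i)) + 1 = _ := zPerm_mul_swap fun h =>
    (Fin.castSucc_lt_last i).ne (sameCycle_extLast_last.1 h)
  rw [zPerm_extLast] at this
  omega

/-- The permutation `α⁻¹ ∘ ζ`. -/
def kreweras (α : Perm (Fin n)) : Perm (Fin n) := α⁻¹ * finRotate n

theorem finRotate_eq_insertLast :
    finRotate (n + 2) = insertLast (finRotate (n + 1)) (some (Fin.last n)) := by
  ext i : 1
  induction i using Fin.lastCases with
  | last => simp [insertLast]
  | cast i =>
    rw [insertLast, Perm.mul_apply]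
    rcases eq_or_ne i (Fin.last n) with rfl | hi
    · rw [swap_apply_right, extLast_last]
      simp
    · rw [swap_apply_of_ne_of_ne (Fin.castSucc_lt_last i).ne
        (fun h => hi (Fin.castSucc_injective _ h)), extLast_castSucc]
      have : (i : ℕ) < n := by
        have := i.2
        have h2 : (i : ℕ) ≠ n := fun h => hi (Fin.ext h)
        omega
      apply Fin.ext
      rw [Fin.val_castSucc, coe_finRotate_of_ne_last hi, coe_finRotate_of_ne_last]
      · rfl
      · exact (Fin.castSucc_lt_last i).ne

theorem kreweras_insertLast_none (α : Perm (Fin (n + 1))) :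
    kreweras (insertLast α none) = insertLast (kreweras α) (some (Fin.last n)) := by
  rw [kreweras, finRotate_eq_insertLast]
  simp only [insertLast, extLast_inv, kreweras, ← mul_assoc]
  congr 1
  ext i : 1
  induction i using Fin.lastCases <;> simp

theorem kreweras_insertLast_some (α : Perm (Fin (n + 1))) (i : Fin (n + 1)) :
    kreweras (insertLast α (some i)) =
      swap (Fin.last (n + 1)) i.castSucc * kreweras (insertLast α none) := by
  simp only [kreweras, insertLast, mul_inv_rev, swap_inv, mul_assoc]

theorem swap_mul_eq_mul_swap (γ : Perm (Fin (n + 1))) :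
    insertLast γ (some (Fin.last n)) =
      swap (Fin.last (n + 1)) (γ (Fin.last n)).castSucc * extLast γ := by
  rw [insertLast, mul_swap_eq_swap_mul, extLast_last, extLast_castSucc]

theorem sameCycle_kreweras_none_castSucc {α : Perm (Fin (n + 1))} {i j : Fin (n + 1)} :
    (kreweras (insertLast α none)).SameCycle i.castSucc j.castSucc ↔
      (kreweras α).SameCycle i j := by
  rw [kreweras_insertLast_none, swap_mul_eq_mul_swap, sameCycle_swap_mul_iff]
  · simp only [sameCycle_extLast_castSucc, sameCycle_extLast_last,
      (Fin.castSucc_lt_last _).ne, false_or]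
    exact ⟨fun h => h.elim id fun h => h.1.symm.trans h.2, Or.inl⟩
  · rw [sameCycle_extLast_last]
    exact (Fin.castSucc_lt_last _).ne

theorem sameCycle_kreweras_none_last {α : Perm (Fin (n + 1))} {j : Fin (n + 1)} :
    (kreweras (insertLast α none)).SameCycle (Fin.last (n + 1)) j.castSucc ↔
      (kreweras α).SameCycle (Fin.last n) j := by
  rw [kreweras_insertLast_none, swap_mul_eq_mul_swap, sameCycle_swap_mul_iff]
  · simp only [sameCycle_extLast_castSucc, sameCycle_extLast_last,
      (Fin.castSucc_lt_last _).ne, false_or, true_or, true_and, Perm.sameCycle_apply_left]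
  · rw [sameCycle_extLast_last]
    exact (Fin.castSucc_lt_last _).ne

theorem zPerm_kreweras_none (α : Perm (Fin (n + 1))) :
    zPerm (kreweras (insertLast α none)) = zPerm (kreweras α) := by
  rw [kreweras_insertLast_none, zPerm_insertLast_some]

theorem zPerm_kreweras_some {α : Perm (Fin (n + 1))} {i : Fin (n + 1)}
    (h : (kreweras α).SameCycle (Fin.last n) i) :
    zPerm (kreweras (insertLast α (some i))) = zPerm (kreweras α) + 1 := by
  rw [kreweras_insertLast_some, zPerm_swap_mul_of_sameCycle, zPerm_kreweras_none]
  · exact sameCycle_kreweras_none_last.2 h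
  · exact (Fin.castSucc_lt_last i).ne'

theorem zPerm_kreweras_some_of_not {α : Perm (Fin (n + 1))} {i : Fin (n + 1)}
    (h : ¬ (kreweras α).SameCycle (Fin.last n) i) :
    zPerm (kreweras (insertLast α (some i))) + 1 = zPerm (kreweras α) := by
  rw [kreweras_insertLast_some, zPerm_swap_mul, zPerm_kreweras_none]
  rwa [sameCycle_kreweras_none_last]

theorem zPerm_fin_one (α : Perm (Fin 1)) : zPerm α = 1 := by
  rw [zPerm, Nat.card_eq_one_iff_unique]
  exact ⟨⟨fun a b => by
    induction a using Quotient.inductionOn with | _ x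
    induction b using Quotient.inductionOn with | _ y
    exact congrArg _ (Subsingleton.elim x y)⟩, ⟨Quotient.mk _ 0⟩⟩

theorem zPerm_add_zPerm_kreweras_le : ∀ {n : ℕ} (α : Perm (Fin (n + 1))),
    zPerm α + zPerm (kreweras α) ≤ n + 2
  | 0, α => by simp [zPerm_fin_one]
  | n + 1, β => by
    obtain ⟨⟨α, o⟩, rfl⟩ := insertLast_bijective.2 β
    have ih := zPerm_add_zPerm_kreweras_le α
    cases o with
    | none =>
      have := zPerm_extLast α
      dsimp only
      rw [zPerm_kreweras_none, insertLast]
      omega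
    | some i =>
      have := zPerm_insertLast_some α i
      dsimp only
      by_cases h : (kreweras α).SameCycle (Fin.last n) i
      · have := zPerm_kreweras_some h
        omega
      · have := zPerm_kreweras_some_of_not h
        omega

end Insertion

section Marks

/-- Either no condition (`b = false`) or the condition of coming from a set partition. -/
def InClass (b : Bool) {n : ℕ} (α : Perm (Fin n)) : Prop :=
  b = true → IsPartitionPerm α

/-- The points after which a new last point may be inserted without leaving the class. -/
def marks (b : Bool) {n : ℕ} (α : Perm (Fin n)) : Finset (Fin n) :=
  univ.filter fun i => b = true → α i ≤ i

variable {b : Bool} {n : ℕ}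

theorem mem_marks {α : Perm (Fin n)} {i : Fin n} : i ∈ marks b α ↔ (b = true → α i ≤ i) := by
  simp [marks]

theorem last_mem_marks (α : Perm (Fin (n + 1))) : Fin.last n ∈ marks b α :=
  mem_marks.2 fun _ => Fin.le_last _

theorem castSucc_mem_marks_none {α : Perm (Fin n)} {j : Fin n} :
    j.castSucc ∈ marks b (insertLast α none) ↔ j ∈ marks b α := by
  simp [mem_marks, insertLast]

theorem castSucc_mem_marks_some {α : Perm (Fin n)} {i j : Fin n} :
    j.castSucc ∈ marks b (insertLast α (some i)) ↔ j ∈ marks b α ∧ (b = true → j ≠ i) := by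
  rcases eq_or_ne j i with rfl | hj
  · cases b <;> simp [mem_marks, insertLast]
  · have : j.castSucc ≠ i.castSucc := fun h => hj (Fin.castSucc_injective _ h)
    simp [mem_marks, insertLast, swap_apply_of_ne_of_ne (Fin.castSucc_lt_last j).ne this, hj]

theorem insertLast_some_castSucc_of_ne (α : Perm (Fin n)) {i j : Fin n} (hj : j ≠ i) :
    insertLast α (some i) j.castSucc = (α j).castSucc := by
  have : j.castSucc ≠ i.castSucc := fun h => hj (Fin.castSucc_injective _ h)
  simp [insertLast, swap_apply_of_ne_of_ne (Fin.castSucc_lt_last j).ne this]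

theorem sameCycle_insertLast_some_castSucc {α : Perm (Fin n)} {i j k : Fin n} :
    (insertLast α (some i)).SameCycle j.castSucc k.castSucc ↔ α.SameCycle j k := by
  rw [insertLast, mul_swap_eq_swap_mul, extLast_last, extLast_castSucc, sameCycle_swap_mul_iff]
  · simp only [sameCycle_extLast_castSucc, sameCycle_extLast_last,
      (Fin.castSucc_lt_last _).ne, false_or]
    exact ⟨fun h => h.elim id fun h => h.1.symm.trans h.2, Or.inl⟩
  · rw [sameCycle_extLast_last]
    exact (Fin.castSucc_lt_last _).ne

theorem sameCycle_insertLast_some_last {α : Perm (Fin n)} {i k : Fin n} :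
    (insertLast α (some i)).SameCycle (Fin.last n) k.castSucc ↔ α.SameCycle i k := by
  rw [← sameCycle_insertLast_some_castSucc (i := i),
    ← Perm.sameCycle_apply_left (x := i.castSucc)]
  simp [insertLast]

theorem isPartitionPerm_insertLast_none {α : Perm (Fin n)} :
    IsPartitionPerm (insertLast α none) ↔ IsPartitionPerm α := by
  constructor
  · rintro h i ⟨h1, j, h2, h3⟩
    exact h i.castSucc ⟨by simpa [insertLast] using h1, j.castSucc,
      sameCycle_extLast_castSucc.2 h2, by simpa [insertLast] using h3⟩
  · rintro h i ⟨h1, j, h2, h3⟩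
    induction i using Fin.lastCases with
    | last => simp [insertLast] at h1
    | cast i =>
      induction j using Fin.lastCases with
      | last => exact absurd h3 (Fin.le_last _).not_gt
      | cast j =>
        exact h i ⟨by simpa [insertLast] using h1, j, sameCycle_extLast_castSucc.1 h2,
          by simpa [insertLast] using h3⟩

theorem isPartitionPerm_insertLast_some {α : Perm (Fin n)} {i : Fin n} :
    IsPartitionPerm (insertLast α (some i)) ↔ IsPartitionPerm α ∧ α i ≤ i := by
  have hlast : insertLast α (some i) (Fin.last n) = (α i).castSucc := by simp [insertLast]
  have hi : insertLast α (some i) i.castSucc = Fin.last n := by simp [insertLast]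
  constructor
  · intro h
    have hmin : ∀ k, α.SameCycle i k → α i ≤ k := by
      intro k hk
      by_contra! hlt
      refine h (Fin.last n) ⟨?_, k.castSucc, sameCycle_insertLast_some_last.2 hk, ?_⟩
      · rw [hlast]
        exact Fin.castSucc_lt_last _
      · rw [hlast]
        exact hlt
    refine ⟨?_, hmin i (Perm.SameCycle.refl _ _)⟩
    rintro j ⟨h1, k, h2, h3⟩
    rcases eq_or_ne j i with rfl | hj
    · exact (hmin k h2).not_gt h3
    · refine h j.castSucc ⟨?_, k.castSucc, sameCycle_insertLast_some_castSucc.2 h2, ?_⟩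
      · rw [insertLast_some_castSucc_of_ne α hj]
        exact h1
      · rw [insertLast_some_castSucc_of_ne α hj]
        exact h3
  · rintro ⟨h, hle⟩ j ⟨h1, k, h2, h3⟩
    induction k using Fin.lastCases with
    | last => exact absurd h3 (Fin.le_last _).not_gt
    | cast k =>
    induction j using Fin.lastCases with
    | last =>
      rw [hlast] at h3
      rw [sameCycle_insertLast_some_last] at h2
      rcases hle.eq_or_lt with e | hlt
      · obtain ⟨m, hm⟩ := h2.exists_nat_pow_eq
        rw [Function.IsFixedPt.perm_pow e m] at hm
        rw [← hm, e] at h3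
        exact lt_irrefl _ h3
      · exact h i ⟨hlt, k, h2, h3⟩
    | cast j =>
      rcases eq_or_ne j i with rfl | hj
      · rw [hi] at h1
        exact absurd h1 (Fin.le_last _).not_gt
      · rw [insertLast_some_castSucc_of_ne α hj] at h1 h3
        exact h j ⟨h1, k, sameCycle_insertLast_some_castSucc.1 h2, h3⟩

theorem inClass_insertLast_none {α : Perm (Fin n)} :
    InClass b (insertLast α none) ↔ InClass b α := by
  simp [InClass, isPartitionPerm_insertLast_none]

theorem inClass_insertLast_some {α : Perm (Fin n)} {i : Fin n} :
    InClass b (insertLast α (some i)) ↔ InClass b α ∧ i ∈ marks b α := by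
  cases b <;> simp [InClass, isPartitionPerm_insertLast_some, mem_marks]

open Classical in
/-- The set of marked points in the cycle of `x` under `α⁻¹ ∘ ζ`. -/
noncomputable def cycleMarks (b : Bool) {n : ℕ} (α : Perm (Fin n)) (x : Fin n) : Finset (Fin n) :=
  (marks b α).filter fun j => (kreweras α).SameCycle x j

theorem mem_cycleMarks {α : Perm (Fin n)} {x j : Fin n} :
    j ∈ cycleMarks b α x ↔ j ∈ marks b α ∧ (kreweras α).SameCycle x j := by
  simp [cycleMarks]

theorem cycleMarks_congr {α : Perm (Fin n)} {x y : Fin n} (h : (kreweras α).SameCycle x y) :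
    cycleMarks b α x = cycleMarks b α y := by
  ext j
  rw [mem_cycleMarks, mem_cycleMarks]
  exact and_congr_right fun _ => ⟨fun h' => h.symm.trans h', fun h' => h.trans h'⟩

/-- The increase of the number of marked points when a point is inserted after a marked point. -/
def gain (b : Bool) : ℕ := if b then 0 else 1

theorem card_cycleMarks_none_castSucc {α : Perm (Fin (n + 1))} {j : Fin (n + 1)}
    (hj : ¬ (kreweras α).SameCycle (Fin.last n) j) :
    (cycleMarks b (insertLast α none) j.castSucc).card = (cycleMarks b α j).card := by
  have : cycleMarks b (insertLast α none) j.castSucc =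
      (cycleMarks b α j).map Fin.castSuccEmb := by
    ext x
    simp only [mem_map, Fin.coe_castSuccEmb]
    induction x using Fin.lastCases with
    | last =>
      simp only [mem_cycleMarks, (Fin.castSucc_lt_last _).ne, and_false, exists_false, iff_false]
      exact fun h => hj (sameCycle_kreweras_none_last.1 h.2.symm)
    | cast x =>
      simp [mem_cycleMarks, castSucc_mem_marks_none, sameCycle_kreweras_none_castSucc]
  rw [this, card_map]

theorem card_cycleMarks_none_last (α : Perm (Fin (n + 1))) :
    (cycleMarks b (insertLast α none) (Fin.last (n + 1))).card =
      (cycleMarks b α (Fin.last n)).card + 1 := by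
  have : cycleMarks b (insertLast α none) (Fin.last (n + 1)) =
      insert (Fin.last (n + 1)) ((cycleMarks b α (Fin.last n)).map Fin.castSuccEmb) := by
    ext x
    simp only [mem_map, Fin.coe_castSuccEmb, mem_insert]
    induction x using Fin.lastCases with
    | last => simp [mem_cycleMarks, last_mem_marks, Perm.SameCycle.refl]
    | cast x =>
      simp [mem_cycleMarks, castSucc_mem_marks_none, sameCycle_kreweras_none_last,
        (Fin.castSucc_lt_last _).ne]
  rw [this, card_insert_of_notMem, card_map]
  simp [(Fin.castSucc_lt_last _).ne]

theorem kreweras_some_not_sameCycle {α : Perm (Fin (n + 1))} {i j : Fin (n + 1)}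
    (hi : (kreweras α).SameCycle (Fin.last n) i) (hj : ¬ (kreweras α).SameCycle (Fin.last n) j)
    (x : Fin (n + 2)) : (kreweras (insertLast α (some i))).SameCycle j.castSucc x ↔
      (kreweras (insertLast α none)).SameCycle j.castSucc x := by
  have h1 := sameCycle_kreweras_none_last.2 hi
  have h2 := sameCycle_iff_swap_mul h1 (Fin.castSucc_lt_last i).ne' j.castSucc x
  rw [← kreweras_insertLast_some] at h2
  have hle : ∀ {x y}, (kreweras (insertLast α (some i))).SameCycle x y →
      (kreweras (insertLast α none)).SameCycle x y := fun {x y} h => by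
    rw [sameCycle_iff_swap_mul h1 (Fin.castSucc_lt_last i).ne', ← kreweras_insertLast_some]
    exact Or.inl h
  refine ⟨hle, fun h => (h2.1 h).elim id fun h' => absurd ?_ hj⟩
  rcases h'.1 with h3 | h3
  · exact sameCycle_kreweras_none_last.1 (hle h3)
  · exact hi.trans (sameCycle_kreweras_none_castSucc.1 (hle h3))

theorem card_cycleMarks_some_castSucc {α : Perm (Fin (n + 1))} {i j : Fin (n + 1)}
    (hi : (kreweras α).SameCycle (Fin.last n) i) (hj : ¬ (kreweras α).SameCycle (Fin.last n) j) :
    (cycleMarks b (insertLast α (some i)) j.castSucc).card = (cycleMarks b α j).card := by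
  rw [← card_cycleMarks_none_castSucc hj]
  congr 1
  ext x
  rw [mem_cycleMarks, mem_cycleMarks, kreweras_some_not_sameCycle hi hj]
  refine and_congr_left fun h => ?_
  induction x using Fin.lastCases with
  | last => simp [last_mem_marks]
  | cast x =>
    rw [castSucc_mem_marks_none, castSucc_mem_marks_some, and_iff_left]
    rintro - rfl
    exact hj (hi.trans (sameCycle_kreweras_none_castSucc.1 h.symm))

theorem card_cycleMarks_some_of_not {α : Perm (Fin (n + 1))} {i : Fin (n + 1)}
    (hi : i ∈ marks b α) (h : ¬ (kreweras α).SameCycle (Fin.last n) i) :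
    (cycleMarks b (insertLast α (some i)) (Fin.last (n + 1))).card =
      (cycleMarks b α (Fin.last n)).card + (cycleMarks b α i).card + gain b := by
  have hsc : ∀ x : Fin (n + 1),
      (kreweras (insertLast α (some i))).SameCycle (Fin.last (n + 1)) x.castSucc ↔
      (kreweras α).SameCycle (Fin.last n) x ∨ (kreweras α).SameCycle i x := by
    intro x
    rw [kreweras_insertLast_some, sameCycle_swap_mul_iff, sameCycle_kreweras_none_last,
      sameCycle_kreweras_none_castSucc]
    · simp only [Perm.SameCycle.refl, true_or, true_and]
      tauto
    · rwa [sameCycle_kreweras_none_last]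
  classical
  have hdisj : Disjoint (cycleMarks b α (Fin.last n)) (cycleMarks b α i) := by
    rw [disjoint_left]
    intro x hx hx'
    exact h ((mem_cycleMarks.1 hx).2.trans (mem_cycleMarks.1 hx').2.symm)
  have hmem : i ∈ cycleMarks b α (Fin.last n) ∪ cycleMarks b α i :=
    mem_union_right _ (mem_cycleMarks.2 ⟨hi, Perm.SameCycle.refl _ _⟩)
  have hnot : ∀ s : Finset (Fin (n + 1)), Fin.last (n + 1) ∉ s.map Fin.castSuccEmb := by
    simp [(Fin.castSucc_lt_last _).ne]
  rw [← card_union_of_disjoint hdisj]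
  cases b with
  | false =>
    have : cycleMarks false (insertLast α (some i)) (Fin.last (n + 1)) =
        insert (Fin.last (n + 1)) ((cycleMarks false α (Fin.last n) ∪
          cycleMarks false α i).map Fin.castSuccEmb) := by
      ext x
      induction x using Fin.lastCases with
      | last => simp [mem_cycleMarks, last_mem_marks, Perm.SameCycle.refl]
      | cast x =>
        rw [mem_cycleMarks, castSucc_mem_marks_some, hsc]
        simp [mem_cycleMarks, (Fin.castSucc_lt_last _).ne, ← and_or_left]
    rw [this, card_insert_of_notMem (hnot _), card_map]
    rfl
  | true =>
    have : cycleMarks true (insertLast α (some i)) (Fin.last (n + 1)) =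
        insert (Fin.last (n + 1)) (((cycleMarks true α (Fin.last n) ∪
          cycleMarks true α i).erase i).map Fin.castSuccEmb) := by
      ext x
      induction x using Fin.lastCases with
      | last => simp [mem_cycleMarks, last_mem_marks, Perm.SameCycle.refl]
      | cast x =>
        rw [mem_cycleMarks, castSucc_mem_marks_some, hsc]
        simp only [mem_cycleMarks, mem_insert, (Fin.castSucc_lt_last _).ne, false_or, mem_map,
          mem_erase, mem_union, Fin.coe_castSuccEmb, Fin.castSucc_inj, exists_eq_right]
        tauto
    rw [this, card_insert_of_notMem (hnot _), card_map, card_erase_of_mem hmem]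
    have := card_pos.2 ⟨i, hmem⟩
    simp only [gain]
    simp
    omega

open Classical in
/-- The position of a marked point `i` among the marked points of the cycle of the last point,
in the cyclic order starting from the last point. -/
noncomputable def markRank (b : Bool) {n : ℕ} (α : Perm (Fin (n + 1))) (i : Fin (n + 1)) : ℕ :=
  ((cycleMarks b α (Fin.last n)).filter fun j =>
    hitTime (kreweras (insertLast α none)) (Fin.last (n + 1)) j.castSucc ≤
      hitTime (kreweras (insertLast α none)) (Fin.last (n + 1)) i.castSucc).card

theorem card_cycleMarks_some_last {α : Perm (Fin (n + 1))} {i : Fin (n + 1)}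
    (hi : i ∈ cycleMarks b α (Fin.last n)) :
    (cycleMarks b (insertLast α (some i)) (Fin.last (n + 1))).card = markRank b α i := by
  classical
  obtain ⟨hm, hs⟩ := mem_cycleMarks.1 hi
  have h1 := sameCycle_kreweras_none_last.2 hs
  have hsc : ∀ x : Fin (n + 1),
      (kreweras (insertLast α (some i))).SameCycle (Fin.last (n + 1)) x.castSucc ↔
      (kreweras α).SameCycle (Fin.last n) x ∧
        hitTime (kreweras (insertLast α none)) (Fin.last (n + 1)) x.castSucc <
          hitTime (kreweras (insertLast α none)) (Fin.last (n + 1)) i.castSucc := by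
    intro x
    rw [kreweras_insertLast_some, sameCycle_swap_mul_left_iff h1 (Fin.castSucc_lt_last i).ne',
      sameCycle_kreweras_none_last]
  set F := (cycleMarks b α (Fin.last n)).filter fun j =>
    hitTime (kreweras (insertLast α none)) (Fin.last (n + 1)) j.castSucc ≤
      hitTime (kreweras (insertLast α none)) (Fin.last (n + 1)) i.castSucc with hF
  have hmem : i ∈ F := by simp [hF, hi]
  have : cycleMarks b (insertLast α (some i)) (Fin.last (n + 1)) =
      insert (Fin.last (n + 1)) ((F.erase i).map Fin.castSuccEmb) := by
    ext x
    induction x using Fin.lastCases with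
    | last => simp [mem_cycleMarks, last_mem_marks, Perm.SameCycle.refl]
    | cast x =>
      rw [mem_cycleMarks, castSucc_mem_marks_some, hsc]
      simp only [hF, mem_cycleMarks, mem_insert, (Fin.castSucc_lt_last _).ne, false_or, mem_map,
        mem_erase, mem_filter, Fin.coe_castSuccEmb, Fin.castSucc_inj, exists_eq_right]
      constructor
      · rintro ⟨⟨h2, -⟩, h3, h4⟩
        exact ⟨fun e => h4.ne (by rw [e]), ⟨h2, h3⟩, h4.le⟩
      · rintro ⟨h2, ⟨h3, h4⟩, h5⟩
        refine ⟨⟨h3, fun _ => h2⟩, h4, lt_of_le_of_ne h5 fun e => h2 ?_⟩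
        exact Fin.castSucc_injective _ (hitTime_inj (sameCycle_kreweras_none_last.2 h4) h1 e)
  rw [this, card_insert_of_notMem (by simp [(Fin.castSucc_lt_last _).ne]), card_map,
    card_erase_of_mem hmem]
  have := card_pos.2 ⟨i, hmem⟩
  rw [markRank, ← hF]
  omega

theorem sameCycle_kreweras_some_or {α : Perm (Fin (n + 1))} {i : Fin (n + 1)}
    (hi : (kreweras α).SameCycle (Fin.last n) i) (x : Fin (n + 2)) :
    (kreweras (insertLast α (some i))).SameCycle (Fin.last (n + 1)) x ∨
      (kreweras (insertLast α (some i))).SameCycle i.castSucc x ↔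
      (kreweras (insertLast α none)).SameCycle (Fin.last (n + 1)) x := by
  rw [sameCycle_iff_swap_mul (sameCycle_kreweras_none_last.2 hi) (Fin.castSucc_lt_last i).ne'
    (Fin.last (n + 1)), ← kreweras_insertLast_some]
  simp only [Perm.SameCycle.refl, true_or, true_and]
  tauto

theorem not_sameCycle_kreweras_some {α : Perm (Fin (n + 1))} {i : Fin (n + 1)}
    (hi : (kreweras α).SameCycle (Fin.last n) i) :
    ¬ (kreweras (insertLast α (some i))).SameCycle (Fin.last (n + 1)) i.castSucc := by
  rw [kreweras_insertLast_some]
  exact not_sameCycle_swap_mul (sameCycle_kreweras_none_last.2 hi) (Fin.castSucc_lt_last i).ne'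

theorem card_cycleMarks_some_castSucc_self {α : Perm (Fin (n + 1))} {i : Fin (n + 1)}
    (hi : i ∈ cycleMarks b α (Fin.last n)) :
    markRank b α i + (cycleMarks b (insertLast α (some i)) i.castSucc).card =
      (cycleMarks b α (Fin.last n)).card + gain b := by
  classical
  obtain ⟨hm, hs⟩ := mem_cycleMarks.1 hi
  have h1 := sameCycle_kreweras_none_last.2 hs
  have hne := (Fin.castSucc_lt_last i).ne'
  have hnot := not_sameCycle_kreweras_some hs
  rw [← card_cycleMarks_some_last hi, ← card_union_of_disjoint]
  swap
  · rw [disjoint_left]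
    intro x hx hx'
    exact hnot ((mem_cycleMarks.1 hx).2.trans (mem_cycleMarks.1 hx').2.symm)
  have hset : cycleMarks b (insertLast α (some i)) (Fin.last (n + 1)) ∪
      cycleMarks b (insertLast α (some i)) i.castSucc =
      (cycleMarks b (insertLast α none) (Fin.last (n + 1))).filter
        fun x => b = true → x ≠ i.castSucc := by
    ext x
    simp only [mem_union, mem_cycleMarks, mem_filter, ← and_or_left, sameCycle_kreweras_some_or hs]
    induction x using Fin.lastCases with
    | last => simp [last_mem_marks, hne]
    | cast x =>
      rw [castSucc_mem_marks_some, castSucc_mem_marks_none, Ne, Ne, Fin.castSucc_inj]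
      tauto
  rw [hset]
  cases b with
  | false =>
    simp [gain, card_cycleMarks_none_last]
  | true =>
    have hmem : i.castSucc ∈ cycleMarks true (insertLast α none) (Fin.last (n + 1)) :=
      mem_cycleMarks.2 ⟨castSucc_mem_marks_none.2 hm, h1⟩
    simp only [forall_const, filter_ne', card_erase_of_mem hmem, card_cycleMarks_none_last]
    simp [gain]

theorem sum_card_filter_le {ι M : Type*} [AddCommMonoid M] (f : ι → ℕ) (φ : ℕ → M) :
    ∀ (s : Finset ι), Set.InjOn f s →
      ∑ i ∈ s, φ ((s.filter fun j => f j ≤ f i).card) = ∑ l ∈ Icc 1 s.card, φ l := by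
  classical
  intro s
  induction s using Finset.induction_on_max_value f with
  | empty => simp
  | insert a s ha hmax ih =>
    intro hinj
    rw [sum_insert ha, card_insert_of_notMem ha, Finset.sum_Icc_succ_top (by omega),
      ← ih (hinj.mono (by simp)), add_comm]
    congr 1
    · refine sum_congr rfl fun i hi => ?_
      rw [filter_insert, if_neg]
      have hne : f a ≠ f i := fun e => ha (by
        rw [hinj (by simp) (by simp [hi]) e]
        exact hi)
      have := hmax i hi
      omega
    · rw [filter_true_of_mem, card_insert_of_notMem ha]
      intro j hj
      rcases mem_insert.1 hj with rfl | hj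
      · exact le_rfl
      · exact hmax j hj

theorem sum_markRank {M : Type*} [AddCommMonoid M] (α : Perm (Fin (n + 1))) (φ : ℕ → M) :
    ∑ i ∈ cycleMarks b α (Fin.last n), φ (markRank b α i) =
      ∑ l ∈ Icc 1 (cycleMarks b α (Fin.last n)).card, φ l := by
  refine sum_card_filter_le (fun j : Fin (n + 1) =>
    hitTime (kreweras (insertLast α none)) (Fin.last (n + 1)) j.castSucc) φ _ ?_
  intro i hi j hj e
  exact Fin.castSucc_injective _ (hitTime_inj
    (sameCycle_kreweras_none_last.2 (mem_cycleMarks.1 hi).2)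
    (sameCycle_kreweras_none_last.2 (mem_cycleMarks.1 hj).2) e)

end Marks

section Recurrences

variable {b : Bool} {n : ℕ}

open Classical in
/-- The marked points outside the cycle of the last point under `α⁻¹ ∘ ζ`. -/
noncomputable def innerMarks (b : Bool) {n : ℕ} (α : Perm (Fin (n + 1))) : Finset (Fin (n + 1)) :=
  (marks b α).filter fun j => ¬ (kreweras α).SameCycle (Fin.last n) j

theorem mem_innerMarks {α : Perm (Fin (n + 1))} {j : Fin (n + 1)} :
    j ∈ innerMarks b α ↔ j ∈ marks b α ∧ ¬ (kreweras α).SameCycle (Fin.last n) j := by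
  simp [innerMarks]

/-- The number of marked points in the cycle of the last point under `α⁻¹ ∘ ζ`. -/
noncomputable def outerCard (b : Bool) {n : ℕ} (α : Perm (Fin (n + 1))) : ℕ :=
  (cycleMarks b α (Fin.last n)).card

open Classical in
/-- The permutations of `Fin (n + 1)` in the class determined by `b`. -/
noncomputable def classPerms (b : Bool) (n : ℕ) : Finset (Perm (Fin (n + 1))) :=
  univ.filter (InClass b)

theorem mem_classPerms {α : Perm (Fin (n + 1))} : α ∈ classPerms b n ↔ InClass b α := by
  simp [classPerms]

theorem classPerms_zero (b : Bool) : classPerms b 0 = {1} := by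
  ext (α : Perm (Fin 1))
  rw [mem_classPerms, mem_singleton]
  refine ⟨fun _ => Subsingleton.elim α 1, fun _ _ i h => h.1.ne ?_⟩
  exact Subsingleton.elim (α := Fin 1) _ _

theorem sum_classPerms_succ {M : Type*} [AddCommMonoid M] (F : Perm (Fin (n + 2)) → M) :
    ∑ β ∈ classPerms b (n + 1), F β = ∑ α ∈ classPerms b n,
      (F (insertLast α none) + ∑ i ∈ cycleMarks b α (Fin.last n), F (insertLast α (some i)) +
        ∑ i ∈ innerMarks b α, F (insertLast α (some i))) := by
  classical
  rw [classPerms, sum_filter, sum_perm_succ, classPerms, sum_filter]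
  refine sum_congr rfl fun α _ => ?_
  simp only [inClass_insertLast_none, inClass_insertLast_some]
  split_ifs with h
  · simp only [h, true_and]
    rw [add_assoc, ← sum_filter, ← sum_filter_add_sum_filter_not _
      fun j => (kreweras α).SameCycle (Fin.last n) j]
    congr 3
    · ext i
      simp [mem_cycleMarks]
    · ext i
      simp [mem_innerMarks]
  · simp [h]

theorem outerCard_none (α : Perm (Fin (n + 1))) :
    outerCard b (insertLast α none) = outerCard b α + 1 :=
  card_cycleMarks_none_last α

theorem innerMarks_none (α : Perm (Fin (n + 1))) :
    innerMarks b (insertLast α none) = (innerMarks b α).map Fin.castSuccEmb := by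
  ext x
  induction x using Fin.lastCases with
  | last => simp [mem_innerMarks, Perm.SameCycle.refl, (Fin.castSucc_lt_last _).ne]
  | cast x => simp [mem_innerMarks, castSucc_mem_marks_none, sameCycle_kreweras_none_last]

theorem sum_innerMarks_some {M : Type*} [AddCommMonoid M] {α : Perm (Fin (n + 1))}
    {i : Fin (n + 1)} (hi : i ∈ cycleMarks b α (Fin.last n)) (f : ℕ → M) :
    ∑ j ∈ innerMarks b (insertLast α (some i)), f (cycleMarks b (insertLast α (some i)) j).card =
      ∑ j ∈ innerMarks b α, f (cycleMarks b α j).card +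
        (outerCard b α + gain b - markRank b α i) •
          f (outerCard b α + gain b - markRank b α i) := by
  classical
  have hs := (mem_cycleMarks.1 hi).2
  have hnot := not_sameCycle_kreweras_some hs
  have hcard : (cycleMarks b (insertLast α (some i)) i.castSucc).card =
      outerCard b α + gain b - markRank b α i := by
    have := card_cycleMarks_some_castSucc_self hi
    rw [outerCard]
    omega
  have hset : innerMarks b (insertLast α (some i)) =
      (innerMarks b α).map Fin.castSuccEmb ∪ cycleMarks b (insertLast α (some i)) i.castSucc := by
    ext x
    have hor := sameCycle_kreweras_some_or hs x
    induction x using Fin.lastCases with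
    | last =>
      simp only [mem_innerMarks, mem_union, mem_cycleMarks, mem_map, Fin.coe_castSuccEmb,
        Perm.SameCycle.refl, (Fin.castSucc_lt_last _).ne, not_true_eq_false, and_false,
        exists_false, false_or, false_iff, not_and]
      exact fun _ h => hnot h.symm
    | cast x =>
      rw [sameCycle_kreweras_none_last] at hor
      simp only [mem_innerMarks, mem_union, mem_cycleMarks, mem_map, Fin.coe_castSuccEmb,
        Fin.castSucc_inj, exists_eq_right, castSucc_mem_marks_some]
      by_cases hx : (kreweras α).SameCycle (Fin.last n) x
      · have : ¬ ((kreweras (insertLast α (some i))).SameCycle (Fin.last (n + 1)) x.castSucc ∧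
          (kreweras (insertLast α (some i))).SameCycle i.castSucc x.castSucc) :=
          fun h => hnot (h.1.trans h.2.symm)
        tauto
      · have hne : x ≠ i := by
          rintro rfl
          exact hx hs
        tauto
  have hdisj : Disjoint ((innerMarks b α).map Fin.castSuccEmb)
      (cycleMarks b (insertLast α (some i)) i.castSucc) := by
    rw [disjoint_left]
    intro x hx hx'
    obtain ⟨y, hy, rfl⟩ := mem_map.1 hx
    exact (mem_innerMarks.1 hy).2 (sameCycle_kreweras_none_last.1
      ((sameCycle_kreweras_some_or hs _).1 (Or.inr (mem_cycleMarks.1 hx').2)))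
  rw [hset, sum_union hdisj, sum_map]
  congr 1
  · refine sum_congr rfl fun j hj => ?_
    rw [Fin.coe_castSuccEmb, card_cycleMarks_some_castSucc hs (mem_innerMarks.1 hj).2]
  · rw [← hcard, ← sum_const]
    refine sum_congr rfl fun j hj => ?_
    rw [cycleMarks_congr (mem_cycleMarks.1 hj).2]

theorem outerCard_some {α : Perm (Fin (n + 1))} {i : Fin (n + 1)}
    (hi : i ∈ cycleMarks b α (Fin.last n)) :
    outerCard b (insertLast α (some i)) = markRank b α i :=
  card_cycleMarks_some_last hi

variable {R : Type*} [CommRing R] (x : R)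

/-- The operator giving the effect of one planar insertion on statistics of `outerCard`. -/
def insertOp (φ : ℕ → R) (L : ℕ) : R := x * φ (L + 1) + ∑ l ∈ Icc 1 L, φ l

open Classical in
/-- The generating function of the permutations of genus `g` in a class. -/
noncomputable def genusSum (b : Bool) (g n : ℕ) (φ : ℕ → R) : R :=
  ∑ α ∈ classPerms b n, if zPerm α + zPerm (kreweras α) + 2 * g = n + 2 then
    x ^ zPerm α * φ (outerCard b α) else 0

open Classical in
/-- The generating function of the permutations of genus `0` in a class with a distinguished
inner marked point. -/
noncomputable def innerSum (b : Bool) (n : ℕ) (ψ : ℕ → ℕ → R) : R :=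
  ∑ α ∈ classPerms b n, if zPerm α + zPerm (kreweras α) = n + 2 then
    x ^ zPerm α * ∑ j ∈ innerMarks b α, ψ (outerCard b α) (cycleMarks b α j).card else 0

theorem zPerm_insertLast_none (α : Perm (Fin n)) : zPerm (insertLast α none) = zPerm α + 1 :=
  zPerm_extLast α

theorem genusSum_planar_part (g : ℕ) (φ : ℕ → R) (α : Perm (Fin (n + 1))) :
    ((if zPerm (insertLast α none) + zPerm (kreweras (insertLast α none)) + 2 * g = n + 1 + 2 then
        x ^ zPerm (insertLast α none) * φ (outerCard b (insertLast α none)) else 0) +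
      ∑ i ∈ cycleMarks b α (Fin.last n),
        if zPerm (insertLast α (some i)) + zPerm (kreweras (insertLast α (some i))) + 2 * g =
            n + 1 + 2 then
          x ^ zPerm (insertLast α (some i)) * φ (outerCard b (insertLast α (some i))) else 0) =
      if zPerm α + zPerm (kreweras α) + 2 * g = n + 2 then
        x ^ zPerm α * insertOp x φ (outerCard b α) else 0 := by
  have h1 : ∀ i ∈ cycleMarks b α (Fin.last n),
      (if zPerm (insertLast α (some i)) + zPerm (kreweras (insertLast α (some i))) + 2 * g =
            n + 1 + 2 then
          x ^ zPerm (insertLast α (some i)) * φ (outerCard b (insertLast α (some i))) else 0) =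
      if zPerm α + zPerm (kreweras α) + 2 * g = n + 2 then
        x ^ zPerm α * φ (markRank b α i) else 0 := by
    intro i hi
    rw [outerCard_some hi, zPerm_insertLast_some, zPerm_kreweras_some (mem_cycleMarks.1 hi).2]
    congr 1
    rw [eq_iff_iff]
    omega
  rw [sum_congr rfl h1, zPerm_insertLast_none, zPerm_kreweras_none, outerCard_none]
  by_cases h : zPerm α + zPerm (kreweras α) + 2 * g = n + 2
  · simp only [if_pos h]
    rw [if_pos (by omega), ← mul_sum, sum_markRank, insertOp, outerCard]
    ring
  · simp only [if_neg h]
    rw [if_neg (by omega)]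
    simp

theorem genusSum_zero_zero (φ : ℕ → R) : genusSum x b 0 0 φ = x * φ 1 := by
  have h : outerCard b (1 : Perm (Fin 1)) = 1 := by
    rw [outerCard, card_eq_one]
    refine ⟨0, eq_singleton_iff_unique_mem.2 ⟨?_, fun j _ =>
      Subsingleton.elim (α := Fin 1) j 0⟩⟩
    exact mem_cycleMarks.2 ⟨last_mem_marks _, Perm.SameCycle.refl _ _⟩
  simp [genusSum, classPerms_zero, zPerm_fin_one, h]

theorem genusSum_zero_succ (n : ℕ) (φ : ℕ → R) :
    genusSum x b 0 (n + 1) φ = genusSum x b 0 n (insertOp x φ) := by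
  rw [genusSum, sum_classPerms_succ, genusSum]
  refine sum_congr rfl fun α _ => ?_
  rw [genusSum_planar_part, add_eq_left]
  refine sum_eq_zero fun i hi => if_neg ?_
  have h1 := zPerm_add_zPerm_kreweras_le α
  have h2 := zPerm_insertLast_some α i
  have h3 := zPerm_kreweras_some_of_not (mem_innerMarks.1 hi).2
  omega

theorem genusSum_one_zero (φ : ℕ → R) : genusSum x b 1 0 φ = 0 := by
  simp [genusSum, zPerm_fin_one]

theorem genusSum_one_succ (n : ℕ) (φ : ℕ → R) :
    genusSum x b 1 (n + 1) φ = genusSum x b 1 n (insertOp x φ) +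
      innerSum x b n fun L q => φ (L + q + gain b) := by
  rw [genusSum, sum_classPerms_succ, genusSum, innerSum, ← sum_add_distrib]
  refine sum_congr rfl fun α _ => ?_
  rw [genusSum_planar_part]
  congr 1
  rw [mul_sum, ite_sum_zero]
  refine sum_congr rfl fun i hi => ?_
  have h2 := zPerm_insertLast_some α i
  have h3 := zPerm_kreweras_some_of_not (mem_innerMarks.1 hi).2
  have h4 : outerCard b (insertLast α (some i)) = _ :=
    card_cycleMarks_some_of_not (mem_innerMarks.1 hi).1 (mem_innerMarks.1 hi).2
  rw [h2, h4, outerCard]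
  congr 1
  rw [eq_iff_iff]
  omega

theorem innerSum_zero (ψ : ℕ → ℕ → R) : innerSum x b 0 ψ = 0 := by
  have h : innerMarks b (1 : Perm (Fin 1)) = ∅ := by
    refine eq_empty_of_forall_notMem fun (j : Fin 1) hj => (mem_innerMarks.1 hj).2 ?_
    rw [Subsingleton.elim j (Fin.last 0)]
  simp [innerSum, classPerms_zero, h]

theorem innerSum_succ (n : ℕ) (ψ : ℕ → ℕ → R) :
    innerSum x b (n + 1) ψ = innerSum x b n (fun L q => insertOp x (fun l => ψ l q) L) +
      genusSum x b 0 n fun L => ∑ l ∈ Icc 1 L,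
        (L + gain b - l) • ψ l (L + gain b - l) := by
  rw [innerSum, sum_classPerms_succ, genusSum, innerSum, ← sum_add_distrib]
  refine sum_congr rfl fun α _ => ?_
  rw [sum_eq_zero (s := innerMarks b α), add_zero]
  swap
  · refine fun i hi => if_neg ?_
    have h1 := zPerm_add_zPerm_kreweras_le α
    have h2 := zPerm_insertLast_some α i
    have h3 := zPerm_kreweras_some_of_not (mem_innerMarks.1 hi).2
    omega
  have h1 : ∀ i ∈ cycleMarks b α (Fin.last n),
      (if zPerm (insertLast α (some i)) + zPerm (kreweras (insertLast α (some i))) =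
            n + 1 + 2 then
          x ^ zPerm (insertLast α (some i)) * ∑ j ∈ innerMarks b (insertLast α (some i)),
            ψ (outerCard b (insertLast α (some i)))
              (cycleMarks b (insertLast α (some i)) j).card else 0) =
      if zPerm α + zPerm (kreweras α) = n + 2 then
        x ^ zPerm α * (∑ j ∈ innerMarks b α, ψ (markRank b α i) (cycleMarks b α j).card +
          (outerCard b α + gain b - markRank b α i) •
            ψ (markRank b α i) (outerCard b α + gain b - markRank b α i)) else 0 := by
    intro i hi
    rw [outerCard_some hi, zPerm_insertLast_some, zPerm_kreweras_some (mem_cycleMarks.1 hi).2,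
      sum_innerMarks_some hi]
    congr 1
    rw [eq_iff_iff]
    omega
  rw [sum_congr rfl h1, zPerm_insertLast_none, zPerm_kreweras_none, outerCard_none,
    innerMarks_none, sum_map]
  by_cases h : zPerm α + zPerm (kreweras α) = n + 2
  · simp only [if_pos h, mul_zero, add_zero]
    rw [if_pos (by omega), ← mul_sum, sum_add_distrib, sum_comm]
    have h2 : ∀ j ∈ innerMarks b α,
        ψ (outerCard b α + 1) (cycleMarks b (insertLast α none) (Fin.castSuccEmb j)).card =
          ψ (outerCard b α + 1) (cycleMarks b α j).card := fun j hj => by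
      rw [Fin.coe_castSuccEmb, card_cycleMarks_none_castSucc (mem_innerMarks.1 hj).2]
    rw [sum_congr rfl h2]
    simp only [insertOp, sum_add_distrib, ← mul_sum]
    rw [sum_markRank α fun r => (outerCard b α + gain b - r) • ψ r (outerCard b α + gain b - r),
      sum_congr rfl fun j _ => sum_markRank α fun r => ψ r (cycleMarks b α j).card]
    rw [← outerCard]
    ring
  · simp only [if_neg h, mul_zero, add_zero]
    rw [if_neg (by omega)]
    simp

end Recurrences

section Algebra

variable {R : Type*} [CommRing R] (x : R)

theorem iterate_insertOp_sum {ι : Type*} (s : Finset ι) (c : ι → R) :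
    ∀ (t : ℕ) (φ : ι → ℕ → R),
      (insertOp x)^[t] (fun L => ∑ i ∈ s, c i * φ i L) =
        fun L => ∑ i ∈ s, c i * (insertOp x)^[t] (φ i) L
  | 0, φ => rfl
  | t + 1, φ => by
    have h : insertOp x (fun L => ∑ i ∈ s, c i * φ i L) =
        fun L => ∑ i ∈ s, c i * insertOp x (φ i) L := by
      funext L
      simp only [insertOp, mul_add, sum_add_distrib, mul_sum]
      rw [sum_comm]
      congr 1
      exact sum_congr rfl fun i _ => by ring
    simp only [Function.iterate_succ_apply, h]
    exact iterate_insertOp_sum s c t _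

theorem iterate_insertOp_mul (t : ℕ) (c : R) (φ : ℕ → R) :
    (insertOp x)^[t] (fun L => c * φ L) = fun L => c * (insertOp x)^[t] φ L := by
  simpa using iterate_insertOp_sum x {()} (fun _ => c) t fun _ => φ

theorem iterate_insertOp_zero (t : ℕ) :
    (insertOp x)^[t] (fun _ => 0) = fun _ => 0 := by
  simpa using iterate_insertOp_sum x (∅ : Finset ℕ) (fun _ => 0) t fun _ _ => 0

/-- The total weight of `b` planar insertions from a given value of `outerCard`. -/
def planarWeight (b : ℕ) : ℕ → R := (insertOp x)^[b] fun _ => 1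

theorem planarWeight_succ (b M : ℕ) :
    planarWeight x (b + 1) (M + 1) = planarWeight x (b + 1) M + x * planarWeight x b (M + 2) -
      x * planarWeight x b (M + 1) + planarWeight x b (M + 1) := by
  simp only [planarWeight, Function.iterate_succ_apply', insertOp]
  rw [sum_Icc_succ_top (by omega)]
  ring

/-- The weight of `a` planar insertions starting from the one-point permutation and ending in
`outerCard = L`. -/
def planarCoeff (a L : ℕ) : R := x * (insertOp x)^[a] (Pi.single L 1) 1

theorem planarCoeff_zero (L : ℕ) : planarCoeff x 0 (L + 2) = 0 := by
  simp [planarCoeff]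

theorem planarCoeff_succ (a L : ℕ) :
    planarCoeff x (a + 1) (L + 1) = planarCoeff x (a + 1) (L + 2) + x * planarCoeff x a L -
      x * planarCoeff x a (L + 1) + planarCoeff x a (L + 1) := by
  have h : insertOp x (Pi.single (L + 1) 1) = fun M => ∑ i : Fin 4,
      (![1, x, - x, 1] : Fin 4 → R) i * (![insertOp x (Pi.single (L + 2) 1), Pi.single L 1,
        Pi.single (L + 1) 1, Pi.single (L + 1) 1] : Fin 4 → ℕ → R) i M := by
    funext M
    rw [Fin.sum_univ_four]
    change _ = 1 * insertOp x (Pi.single (L + 2) 1) M + x * Pi.single (M := fun _ => R) L 1 M +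
      -x * Pi.single (M := fun _ => R) (L + 1) 1 M + 1 * Pi.single (M := fun _ => R) (L + 1) 1 M
    simp only [insertOp, Pi.single_apply, sum_ite_eq', mem_Icc]
    split_ifs <;> first | omega | ring
  simp only [planarCoeff, Function.iterate_succ_apply]
  rw [h, iterate_insertOp_sum]
  simp only [Fin.sum_univ_four]
  simp
  ring

open PowerSeries in
theorem planar_symmetry_aux {g f : ℕ → ℕ → R} (hg0 : ∀ L, g 0 (L + 2) = 0)
    (hg : ∀ a L, g (a + 1) (L + 1) =
      g (a + 1) (L + 2) + x * g a L - x * g a (L + 1) + g a (L + 1))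
    (hgv : ∀ a L, a + 1 < L → g a L = 0)
    (hf0 : ∀ M, f 0 M = 1)
    (hf : ∀ b M, f (b + 1) (M + 1) =
      f (b + 1) M + x * f b (M + 2) - x * f b (M + 1) + f b (M + 1)) (s L M : ℕ) :
    ∑ p ∈ antidiagonal (s + 1), g p.1 (L + 2) * f p.2 M =
      x * ∑ p ∈ antidiagonal s, g p.1 (L + 1) * f p.2 (M + 1) := by
  set G : ℕ → R⟦X⟧ := fun L => mk fun a => g a L with hG
  set F : ℕ → R⟦X⟧ := fun M => mk fun b => f b M with hF
  have hGr : ∀ L, (1 + X * C (x - 1)) * G (L + 2) = X * C x * G (L + 1) + G (L + 3) := by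
    intro L
    ext (_ | a)
    · simp [hG, hg0, add_mul, mul_assoc]
    · simp only [hG, add_mul, one_mul, mul_assoc, map_add, coeff_succ_X_mul, coeff_C_mul,
        coeff_mk, hg a (L + 1)]
      ring
  have hFr : ∀ M, (1 + X * C (x - 1)) * F (M + 1) = F M + X * C x * F (M + 2) := by
    intro M
    ext (_ | b)
    · simp [hF, hf0, add_mul, mul_assoc]
    · simp only [hF, add_mul, one_mul, mul_assoc, map_add, coeff_succ_X_mul, coeff_C_mul,
        coeff_mk, hf b M]
      ring
  set V : ℕ → ℕ → R⟦X⟧ := fun L M => G (L + 2) * F M - X * (C x * (G (L + 1) * F (M + 1))) with hV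
  have hVr : ∀ L M, V L M = V (L + 1) M + X * (C x * V L (M + 1)) - X * (C (x - 1) * V L M) := by
    intro L M
    simp only [hV]
    linear_combination F M * hGr L - X * C x * G (L + 1) * hFr M
  have hV0 : ∀ s L M, s ≤ L → coeff s (V L M) = 0 := by
    intro s L M hs
    simp only [hV, map_sub]
    have h1 : coeff s (G (L + 2) * F M) = 0 := by
      rw [coeff_mul]
      refine sum_eq_zero fun p hp => ?_
      have := mem_antidiagonal.1 hp
      rw [hG, coeff_mk, hgv _ _ (by omega), zero_mul]
    have h2 : coeff s (X * (C x * (G (L + 1) * F (M + 1)))) = 0 := by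
      cases s with
      | zero => simp
      | succ s =>
        rw [coeff_succ_X_mul, coeff_C_mul, coeff_mul, sum_eq_zero, mul_zero]
        intro p hp
        have := mem_antidiagonal.1 hp
        rw [hG, coeff_mk, hgv _ _ (by omega), zero_mul]
    rw [h1, h2, sub_zero]
  have hVz : ∀ s L M, coeff s (V L M) = 0 := by
    intro s
    induction s with
    | zero => exact fun L M => hV0 0 L M (Nat.zero_le _)
    | succ s ih =>
      have hstep : ∀ k L M, coeff (s + 1) (V L M) = coeff (s + 1) (V (L + k) M) := by
        intro k
        induction k with
        | zero => simp
        | succ k ihk =>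
          intro L M
          rw [ihk, hVr]
          rw [map_sub, map_add, coeff_succ_X_mul, coeff_succ_X_mul, coeff_C_mul, coeff_C_mul, ih,
            ih, mul_zero, mul_zero, sub_zero, add_zero, add_assoc]
      intro L M
      rw [hstep (s + 1) L M]
      exact hV0 _ _ _ (by omega)
  have := hVz (s + 1) L M
  rw [hV, map_sub, coeff_succ_X_mul, coeff_C_mul, coeff_mul, coeff_mul] at this
  simpa [hG, hF] using sub_eq_zero.1 this

end Algebra

section PlanarExpansion

variable {R : Type*} [CommRing R] (x : R) {b : Bool}

theorem genusSum_zero_eq : ∀ (a : ℕ) (φ : ℕ → R),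
    genusSum x b 0 a φ = x * (insertOp x)^[a] φ 1
  | 0, φ => genusSum_zero_zero x φ
  | a + 1, φ => by
    rw [genusSum_zero_succ, genusSum_zero_eq a, Function.iterate_succ_apply]

theorem outerCard_le {n : ℕ} (α : Perm (Fin (n + 1))) : outerCard b α ≤ n + 1 :=
  (card_le_univ _).trans (by simp)

theorem planarCoeff_eq_zero {a L : ℕ} (h : a + 1 < L) : planarCoeff x a L = 0 := by
  rw [planarCoeff, ← genusSum_zero_eq (b := true), genusSum]
  refine sum_eq_zero fun α _ => ?_
  have := outerCard_le (b := true) α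
  rw [Pi.single_eq_of_ne (by omega), mul_zero, mul_zero, ite_self]

theorem genusSum_zero_eq_sum {a N : ℕ} (hN : a + 2 ≤ N) (φ : ℕ → R) :
    genusSum x b 0 a φ = ∑ L ∈ range N, planarCoeff x a L * φ L := by
  have h : ∀ L, planarCoeff x a L * φ L = genusSum x b 0 a (Pi.single L (φ L)) := by
    intro L
    have : (Pi.single L (φ L) : ℕ → R) = fun M => φ L * Pi.single (M := fun _ => R) L 1 M := by
      funext M
      simp [Pi.single_apply]
    rw [genusSum_zero_eq, this, iterate_insertOp_mul, planarCoeff]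
    ring
  simp only [h, genusSum]
  rw [sum_comm]
  refine sum_congr rfl fun α _ => ?_
  have := outerCard_le (b := b) α
  rw [sum_ite_irrel, sum_const_zero, ← mul_sum, sum_pi_single,
    if_pos (mem_range.2 (by omega : outerCard b α < N))]

theorem planar_symmetry_succ (s L M : ℕ) :
    ∑ p ∈ antidiagonal (s + 1), planarCoeff x p.1 (L + 2) * planarWeight x p.2 M =
      x * ∑ p ∈ antidiagonal s, planarCoeff x p.1 (L + 1) * planarWeight x p.2 (M + 1) :=
  planar_symmetry_aux x (planarCoeff_zero x) (planarCoeff_succ x)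
    (fun _ _ => planarCoeff_eq_zero x) (fun _ => rfl) (planarWeight_succ x) s L M

theorem genusSum_one_eq : ∀ (n : ℕ) (φ : ℕ → R),
    genusSum x b 1 (n + 1) φ = ∑ p ∈ antidiagonal n,
      innerSum x b p.1 fun L q => (insertOp x)^[p.2] φ (L + q + gain b)
  | 0, φ => by simp [genusSum_one_succ, genusSum_one_zero]
  | n + 1, φ => by
    rw [genusSum_one_succ, genusSum_one_eq n, Nat.sum_antidiagonal_succ', add_comm]
    simp only [Function.iterate_succ_apply, Function.iterate_zero, id]

theorem innerSum_eq : ∀ (n : ℕ) (ψ : ℕ → ℕ → R),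
    innerSum x b (n + 1) ψ = ∑ p ∈ antidiagonal n,
      genusSum x b 0 p.1 fun L => ∑ l ∈ Icc 1 L, (L + gain b - l) •
        (insertOp x)^[p.2] (fun k => ψ k (L + gain b - l)) l
  | 0, ψ => by simp [innerSum_succ, innerSum_zero]
  | n + 1, ψ => by
    rw [innerSum_succ, innerSum_eq n, Nat.sum_antidiagonal_succ', add_comm]
    simp only [Function.iterate_succ_apply, Function.iterate_zero, id]

/-- The contribution to genus one of `a` planar insertions, the opening of an inner cycle, `t`
further planar insertions, the merging of the inner cycle and `c` final planar insertions. -/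
noncomputable def handleTerm (b : Bool) (a t c : ℕ) : R :=
  genusSum x b 0 a fun L => ∑ l ∈ Icc 1 L, (L + gain b - l) •
    (insertOp x)^[t] (fun k => planarWeight x c (k + (L + gain b - l) + gain b)) l

theorem sum_antidiagonal_comm {M : Type*} [AddCommMonoid M] (F : ℕ → ℕ → ℕ → M) (n : ℕ) :
    ∑ p ∈ antidiagonal n, ∑ q ∈ antidiagonal p.1, F q.1 q.2 p.2 =
      ∑ p ∈ antidiagonal n, ∑ q ∈ antidiagonal p.1, F q.1 p.2 q.2 := by
  rw [sum_sigma', sum_sigma']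
  refine sum_bij' (fun p _ => ⟨(p.2.1 + p.1.2, p.2.2), (p.2.1, p.1.2)⟩)
    (fun p _ => ⟨(p.2.1 + p.1.2, p.2.2), (p.2.1, p.1.2)⟩) ?_ ?_ ?_ ?_ ?_
  · rintro ⟨⟨p, q⟩, ⟨r, s⟩⟩ h
    simp only [mem_sigma, HasAntidiagonal.mem_antidiagonal] at h ⊢
    exact ⟨by omega, trivial⟩
  · rintro ⟨⟨p, q⟩, ⟨r, s⟩⟩ h
    simp only [mem_sigma, HasAntidiagonal.mem_antidiagonal] at h ⊢
    exact ⟨by omega, trivial⟩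
  · rintro ⟨⟨p, q⟩, ⟨r, s⟩⟩ h
    simp only [mem_sigma, HasAntidiagonal.mem_antidiagonal] at h
    simp [h.2]
  · rintro ⟨⟨p, q⟩, ⟨r, s⟩⟩ h
    simp only [mem_sigma, HasAntidiagonal.mem_antidiagonal] at h
    simp [h.2]
  · intros
    rfl

theorem genusSum_one_eq_handleTerm (n : ℕ) :
    genusSum x b 1 (n + 2) (fun _ => 1) = ∑ p ∈ antidiagonal n, ∑ q ∈ antidiagonal p.1,
      handleTerm x b q.1 p.2 q.2 := by
  rw [genusSum_one_eq, Nat.sum_antidiagonal_succ, innerSum_zero, zero_add,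
    ← sum_antidiagonal_comm fun a t c => handleTerm x b a t c]
  simp only [innerSum_eq]
  rfl

theorem sum_range_sum_Icc {M : Type*} [AddCommMonoid M] {N : ℕ} {H : ℕ → ℕ → M}
    (hH : ∀ L l, N ≤ L → H L l = 0) :
    ∑ L ∈ range N, ∑ l ∈ Icc 1 L, H L l =
      ∑ l ∈ range N, ∑ r ∈ range N, H (l + 1 + r) (l + 1) := by
  have h1 : ∑ L ∈ range N, ∑ l ∈ Icc 1 L, H L l = ∑ l ∈ Ico 1 (N + 1), ∑ L ∈ Ico l N, H L l :=
    sum_comm' fun L l => by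
      simp only [mem_range, mem_Icc, mem_Ico]
      omega
  rw [h1, sum_Ico_eq_sum_range]
  refine sum_congr rfl fun l _ => ?_
  rw [sum_Ico_eq_sum_range, add_comm 1 l]
  refine sum_subset (range_subset_range.2 (by omega)) fun r _ hr => hH _ _ ?_
  rw [mem_range] at hr
  omega

theorem handleTerm_false {a N : ℕ} (hN : a + 2 ≤ N) (t c : ℕ) :
    handleTerm x false a t c = ∑ l ∈ range N, ∑ r ∈ range N, (r + 1) •
      (planarCoeff x a (l + r + 1) *
        (insertOp x)^[t] (fun k => planarWeight x c (k + r + 2)) (l + 1)) := by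
  rw [handleTerm, genusSum_zero_eq_sum x hN]
  simp only [mul_sum]
  rw [sum_range_sum_Icc fun L l hL => by rw [planarCoeff_eq_zero x (by omega), zero_mul]]
  refine sum_congr rfl fun l _ => sum_congr rfl fun r _ => ?_
  have h : l + 1 + r + gain false - (l + 1) = r + 1 := by
    simp only [gain]
    simp
    omega
  rw [h, mul_smul_comm, show l + 1 + r = l + r + 1 by omega]
  rfl

theorem handleTerm_true {a N : ℕ} (hN : a + 2 ≤ N) (t c : ℕ) :
    handleTerm x true a t c = ∑ l ∈ range N, ∑ r ∈ range N, (r + 1) •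
      (planarCoeff x a (l + r + 2) *
        (insertOp x)^[t] (fun k => planarWeight x c (k + r + 1)) (l + 1)) := by
  rw [handleTerm, genusSum_zero_eq_sum x hN]
  simp only [mul_sum]
  rw [sum_range_sum_Icc fun L l hL => by rw [planarCoeff_eq_zero x (by omega), zero_mul]]
  refine sum_congr rfl fun l _ => ?_
  have h : ∀ r, l + 1 + r + gain true - (l + 1) = r := by
    intro r
    simp [gain]
  simp only [h]
  have h2 := sum_range_succ (fun r => planarCoeff x a (l + 1 + r) *
    r • (insertOp x)^[t] (fun k => planarWeight x c (k + r + gain true)) (l + 1)) N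
  rw [sum_range_succ', zero_smul, mul_zero, add_zero, planarCoeff_eq_zero x (by omega), zero_mul,
    add_zero] at h2
  rw [← h2]
  refine sum_congr rfl fun r _ => ?_
  rw [mul_smul_comm, show l + 1 + (r + 1) = l + r + 2 by omega]
  rfl

theorem sum_handleTerm {s N : ℕ} (f : ℕ → ℕ → ℕ → R) (t u v w : ℕ)
    (hf : ∀ a c, a ≤ s → f a t c = ∑ l ∈ range N, ∑ r ∈ range N, (r + 1) •
      (planarCoeff x a (l + r + u) *
        (insertOp x)^[t] (fun k => planarWeight x c (k + r + v)) (l + w))) :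
    ∑ q ∈ antidiagonal s, f q.1 t q.2 = ∑ l ∈ range N, ∑ r ∈ range N, (r + 1) •
      (insertOp x)^[t] (fun k => ∑ q ∈ antidiagonal s,
        planarCoeff x q.1 (l + r + u) * planarWeight x q.2 (k + r + v)) (l + w) := by
  rw [sum_congr rfl fun q hq => hf q.1 q.2 (by have := HasAntidiagonal.mem_antidiagonal.1 hq; omega), sum_comm]
  refine sum_congr rfl fun l _ => ?_
  rw [sum_comm]
  refine sum_congr rfl fun r _ => ?_
  rw [← smul_sum, iterate_insertOp_sum]

theorem sum_handleTerm_zero (t : ℕ) :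
    ∑ q ∈ antidiagonal 0, handleTerm x true q.1 t q.2 = 0 := by
  rw [sum_handleTerm x (handleTerm x true) t 2 1 1 (N := 2)
    fun a c ha => handleTerm_true x (by omega) t c]
  simp [planarCoeff_zero, iterate_insertOp_zero]

theorem sum_handleTerm_succ (s t : ℕ) :
    ∑ q ∈ antidiagonal (s + 1), handleTerm x true q.1 t q.2 =
      x * ∑ q ∈ antidiagonal s, handleTerm x false q.1 t q.2 := by
  rw [sum_handleTerm x (handleTerm x true) t 2 1 1 (N := s + 3)
      fun a c ha => handleTerm_true x (by omega) t c,
    sum_handleTerm x (handleTerm x false) t 1 2 1 (N := s + 3)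
      fun a c ha => handleTerm_false x (by omega) t c]
  simp only [planar_symmetry_succ, iterate_insertOp_mul]
  simp only [mul_sum, mul_smul_comm]

theorem genusSum_one_true_succ (n : ℕ) :
    genusSum x true 1 (n + 1) (fun _ => 1) = x * genusSum x false 1 n fun _ => 1 := by
  match n with
  | 0 => simp [genusSum_one_succ, genusSum_one_zero, innerSum_zero]
  | 1 =>
    rw [genusSum_one_eq_handleTerm, genusSum_one_succ, genusSum_one_zero, innerSum_zero]
    have := sum_handleTerm_zero x 0
    simpa using this
  | n + 2 =>
    rw [genusSum_one_eq_handleTerm, genusSum_one_eq_handleTerm, Nat.sum_antidiagonal_succ,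
      sum_handleTerm_zero, zero_add, mul_sum]
    exact sum_congr rfl fun p _ => sum_handleTerm_succ x p.1 p.2

open Polynomial in
theorem coeff_genusSum (b : Bool) (n k : ℕ) :
    (genusSum (X : ℤ[X]) b 1 n fun _ => 1).coeff k =
      Nat.card {α : Perm (Fin (n + 1)) // IsGenusOne α ∧ InClass b α ∧ zPerm α = k} := by
  classical
  rw [genusSum, finsetSum_coeff, Nat.card_eq_fintype_card, Fintype.card_subtype, card_filter,
    classPerms, sum_filter, Nat.cast_sum]
  refine sum_congr rfl fun α _ => ?_
  have h : zPerm α + zPerm (kreweras α) + 2 * 1 = n + 2 ↔ IsGenusOne α := Iff.rfl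
  simp only [h, mul_one]
  by_cases h1 : IsGenusOne α <;> by_cases h2 : InClass b α <;>
    simp [h1, h2, coeff_X_pow, eq_comm]

end PlanarExpansion

end GenusOne

/-- **Yip's conjecture.** For `n ≥ 2` and `k ≥ 2`, the number of set partitions of
`{1,…,n}` of genus 1 with exactly `k` blocks equals the number of permutations of
`{1,…,n−1}` of genus 1 with exactly `k−1` cycles. -/
theorem yip_conjecture (n k : ℕ) (hn : 2 ≤ n) (hk : 2 ≤ k) :
    Nat.card {α : Equiv.Perm (Fin n) // IsGenusOne α ∧ IsPartitionPerm α ∧ zPerm α = k} =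
      Nat.card {β : Equiv.Perm (Fin (n - 1)) // IsGenusOne β ∧ zPerm β = k - 1} := by
  obtain ⟨n, rfl⟩ := Nat.exists_eq_add_of_le' hn
  obtain ⟨k, rfl⟩ := Nat.exists_eq_add_of_le' hk
  have h := congrArg (fun p => Polynomial.coeff p (k + 2))
    (genusSum_one_true_succ (Polynomial.X : Polynomial ℤ) n)
  simp only [Polynomial.coeff_X_mul, coeff_genusSum, Nat.cast_inj, InClass, forall_const,
    reduceCtorEq, false_imp_iff, true_and] at h
  exact h
end

section
/- For all integers n ≥ 2 and k ≥ 2, if p₀(n,k) denotes the number of set partitions of {1,…,n} of genus 1 having exactly k blocks, then 6·p₀(n,k) = C(n,2)·C(n−2,k)·C(n−2,k−2), where C(a,b) denotes the binomial coefficient. -/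
section genusOnePartitions

open Equiv Equiv.Perm

/-- Extend a permutation of `Fin n` to `Fin (n + 1)` by inserting `t` as a fixed point. -/
def insertFixed {n : ℕ} (t : Fin (n + 1)) (σ : Perm (Fin n)) : Perm (Fin (n + 1)) :=
  σ.extendDomain (finSuccAboveEquiv t)

section insertFixed

variable {n : ℕ} (t : Fin (n + 1)) (σ τ : Perm (Fin n))

@[simp] lemma insertFixed_self : insertFixed t σ t = t :=
  extendDomain_apply_not_subtype _ _ (by simp)

@[simp] lemma insertFixed_succAbove (y : Fin n) :
    insertFixed t σ (t.succAbove y) = t.succAbove (σ y) :=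
  extendDomain_apply_image σ (finSuccAboveEquiv t) y

lemma insertFixed_mul : insertFixed t (σ * τ) = insertFixed t σ * insertFixed t τ :=
  (extendDomain_mul _ _ _).symm

lemma insertFixed_inv : insertFixed t σ⁻¹ = (insertFixed t σ)⁻¹ :=
  (extendDomain_inv _ _).symm

lemma insertFixed_injective : Function.Injective (insertFixed t) :=
  extendDomainHom_injective _

@[simp] lemma cycleType_insertFixed : (insertFixed t σ).cycleType = σ.cycleType :=
  cycleType_extendDomain _

variable {t}

lemma exists_insertFixed_eq {α : Perm (Fin (n + 1))} (h : α t = t) :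
    ∃ σ, insertFixed t σ = α := by
  refine ⟨(finSuccAboveEquiv t).permCongr.symm (α.subtypePerm (p := fun x => x ≠ t) ?_), ?_⟩
  · intro x
    rw [not_iff_not]
    constructor
    · intro hx; rw [← h] at hx; exact α.injective hx
    · rintro rfl; exact h
  · ext x
    rcases Fin.eq_self_or_eq_succAbove t x with rfl | ⟨y, rfl⟩
    · simp [h]
    · rw [insertFixed_succAbove]
      congr 1
      change ((finSuccAboveEquiv t) ((finSuccAboveEquiv t).symm _) : Fin (n + 1)) = _
      rw [Equiv.apply_symm_apply]
      rfl

end insertFixed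

lemma val_finRotate {n : ℕ} (i : Fin n) :
    (finRotate n i : ℕ) = if (i : ℕ) + 1 = n then 0 else (i : ℕ) + 1 := by
  rcases n with _ | n
  · exact i.elim0
  · rw [coe_finRotate]
    simp [Fin.ext_iff]

lemma val_succAbove {n : ℕ} (t : Fin (n + 1)) (y : Fin n) :
    (t.succAbove y : ℕ) = if (y : ℕ) < t then (y : ℕ) else y + 1 := by
  rw [Fin.succAbove]
  split_ifs <;> simp_all [Fin.lt_def]

lemma finRotate_ne_self {n : ℕ} (hn : 2 ≤ n) (i : Fin n) : finRotate n i ≠ i := by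
  rw [Ne, Fin.ext_iff, val_finRotate]
  split_ifs <;> omega

lemma finRotate_succAbove_of_ne {n : ℕ} (t : Fin (n + 1)) (y : Fin n)
    (h : finRotate (n + 1) (t.succAbove y) ≠ t) :
    finRotate (n + 1) (t.succAbove y) = t.succAbove (finRotate n y) := by
  rw [Ne, Fin.ext_iff] at h
  rw [Fin.ext_iff]
  simp only [val_finRotate, val_succAbove] at h ⊢
  split_ifs at h ⊢ <;> omega

lemma succAbove_finRotate_of_eq {n : ℕ} (t : Fin (n + 1)) (y : Fin n)
    (h : finRotate (n + 1) (t.succAbove y) = t) :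
    t.succAbove (finRotate n y) = finRotate (n + 1) t := by
  rw [Fin.ext_iff] at h
  rw [Fin.ext_iff]
  simp only [val_finRotate, val_succAbove] at h ⊢
  split_ifs at h ⊢ <;> omega

/-- Deleting the point `t` from the long cycle on `Fin (n + 1)` leaves the long cycle on `Fin n`. -/
lemma finRotate_succ_eq_swap_mul {n : ℕ} (t : Fin (n + 1)) :
    finRotate (n + 1) = swap t (finRotate (n + 1) t) * insertFixed t (finRotate n) := by
  refine Equiv.ext fun x => ?_
  rcases Fin.eq_self_or_eq_succAbove t x with rfl | ⟨y, rfl⟩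
  · simp
  · rw [Perm.mul_apply, insertFixed_succAbove]
    by_cases h : finRotate (n + 1) (t.succAbove y) = t
    · rw [succAbove_finRotate_of_eq t y h, swap_apply_right, h]
    · rw [← finRotate_succAbove_of_ne t y h, swap_apply_of_ne_of_ne h]
      exact fun h' => t.succAbove_ne y ((finRotate (n + 1)).injective h')

section zPerm

/-- A map commuting with two permutations up to cycles induces a map on cycles. -/
lemma sameCycle_map {m n : ℕ} {σ : Perm (Fin m)} {τ : Perm (Fin n)} (φ : Fin m → Fin n)
    (h : ∀ x, τ.SameCycle (φ x) (φ (σ x))) {x y : Fin m} (hxy : σ.SameCycle x y) :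
    τ.SameCycle (φ x) (φ y) := by
  obtain ⟨k, -, -, rfl⟩ := hxy.exists_pow_eq''
  generalize k = k
  clear hxy
  induction k with
  | zero => exact SameCycle.refl _ _
  | succ k ih => exact ih.trans (by rw [pow_succ', Perm.mul_apply]; exact h _)

lemma zPerm_swap_mul_insertFixed {n : ℕ} (t c : Fin (n + 1)) (hc : c ≠ t) (σ : Perm (Fin n)) :
    zPerm (swap t c * insertFixed t σ) = zPerm σ := by
  obtain ⟨c, rfl⟩ := Fin.exists_succAbove_eq hc
  set τ := swap t (t.succAbove c) * insertFixed t σ with hτ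
  have h1 : τ t = t.succAbove c := by simp [hτ]
  have h2 : ∀ y, σ y ≠ c → τ (t.succAbove y) = t.succAbove (σ y) := by
    intro y hy
    rw [hτ, Perm.mul_apply, insertFixed_succAbove, swap_apply_of_ne_of_ne (t.succAbove_ne _)]
    simpa using hy
  have h3 : ∀ y, σ y = c → τ (t.succAbove y) = t := by
    intro y hy
    rw [hτ, Perm.mul_apply, insertFixed_succAbove, hy, swap_apply_right]
  have hs : ∀ x, τ.SameCycle x (τ x) := fun x => (SameCycle.refl τ x).apply_right
  have hs' : ∀ x, σ.SameCycle x (σ x) := fun x => (SameCycle.refl σ x).apply_right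
  let ρ : Fin (n + 1) → Fin n := fun x => t.succAboveCases (α := fun _ => Fin n) c id x
  have ρt : ρ t = c := by simp [ρ]
  have ρe : ∀ y, ρ (t.succAbove y) = y := by simp [ρ]
  have hE : ∀ y, τ.SameCycle (t.succAbove y) (t.succAbove (σ y)) := by
    intro y
    by_cases hy : σ y = c
    · have h4 := hs (t.succAbove y)
      have h5 := hs t
      rw [h3 y hy] at h4
      rw [h1, ← hy] at h5
      exact h4.trans h5
    · rw [← h2 y hy]
      exact hs _
  have hρ : ∀ x, σ.SameCycle (ρ x) (ρ (τ x)) := by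
    intro x
    rcases Fin.eq_self_or_eq_succAbove t x with rfl | ⟨y, rfl⟩
    · rw [h1, ρt, ρe]
    · by_cases hy : σ y = c
      · rw [h3 y hy, ρt, ρe, ← hy]
        exact hs' y
      · rw [h2 y hy, ρe, ρe]
        exact hs' y
  refine Nat.card_congr ⟨Quotient.map' ρ fun _ _ h => sameCycle_map ρ hρ h,
    Quotient.map' t.succAbove fun _ _ h => sameCycle_map _ hE h, ?_, ?_⟩
  · intro q
    induction q using Quotient.inductionOn' with
    | h x =>
      refine Quotient.sound' ?_
      change τ.SameCycle _ _
      rcases Fin.eq_self_or_eq_succAbove t x with rfl | ⟨y, rfl⟩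
      · rw [ρt, ← h1]
        exact (hs _).symm
      · rw [ρe]
  · intro q
    induction q using Quotient.inductionOn' with
    | h x =>
      refine Quotient.sound' ?_
      rw [ρe]

/-- The number of cycles in terms of the cycle type, which omits the fixed points. -/
lemma zPerm_add_sum_cycleType {n : ℕ} (σ : Perm (Fin n)) :
    zPerm σ + σ.cycleType.sum = σ.cycleType.card + n := by
  let F : Fin n → Perm (Fin n) ⊕ Fin n := fun x => if σ x = x then .inr x else .inl (σ.cycleOf x)
  have hF : cycleSetoid σ = Setoid.ker F := by
    ext x y
    change σ.SameCycle x y ↔ F x = F y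
    by_cases hx : σ x = x
    · have h1 : σ.SameCycle x y ↔ x = y :=
        ⟨fun h => h.eq_of_left hx, fun h => h ▸ SameCycle.refl _ _⟩
      by_cases hy : σ y = y
      · simp [F, hx, hy, h1]
      · rw [h1]
        simp only [F, hx, hy, if_true, if_false, reduceCtorEq, iff_false]
        rintro rfl
        exact hy hx
    · by_cases hy : σ y = y
      · simp only [F, hx, hy, if_true, if_false, reduceCtorEq, iff_false]
        intro h
        exact hx (h.symm.eq_of_left hy ▸ hy)
      · simp only [F, hx, hy, if_false, Sum.inl.injEq]
        exact sameCycle_iff_cycleOf_eq_of_mem_support (mem_support.2 hx) (mem_support.2 hy)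
  have hz : zPerm σ = (Finset.univ.image F).card := by
    rw [zPerm, hF, Nat.card_congr (Setoid.quotientKerEquivRange F), ← Set.image_univ,
      ← Finset.coe_univ, ← Finset.coe_image]
    exact Nat.card_eq_card_toFinset _ |>.trans (by simp)
  have himage : Finset.univ.image F =
      σ.cycleFactorsFinset.disjSum (Finset.univ.filter fun x => σ x = x) := by
    ext c
    rcases c with c | x
    · simp only [F, Finset.mem_image, Finset.mem_univ, true_and, Finset.inl_mem_disjSum]
      constructor
      · rintro ⟨x, hx⟩
        split_ifs at hx with h
        rw [← Sum.inl.inj hx, cycleOf_mem_cycleFactorsFinset_iff, mem_support]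
        exact h
      · intro hc
        obtain ⟨x, hx⟩ := (mem_cycleFactorsFinset_iff.1 hc).1.nonempty_support
        have hx' := mem_cycleFactorsFinset_support_le hc hx
        refine ⟨x, ?_⟩
        rw [if_neg (mem_support.1 hx'), cycle_is_cycleOf hx hc]
    · simp only [F, Finset.mem_image, Finset.mem_univ, true_and, Finset.inr_mem_disjSum,
        Finset.mem_filter]
      constructor
      · rintro ⟨y, hy⟩
        split_ifs at hy with h
        rwa [← Sum.inr.inj hy]
      · intro hx
        exact ⟨x, by rw [if_pos hx]⟩
  have hfix : (Finset.univ.filter fun x => σ x = x).card + σ.support.card = n := by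
    have := Finset.card_filter_add_card_filter_not (s := Finset.univ) (fun x => σ x = x)
    rwa [Finset.card_univ, Fintype.card_fin] at this
  rw [hz, himage, Finset.card_disjSum, sum_cycleType, cycleType_def, Multiset.card_map,
    Finset.card_val]
  omega

lemma zPerm_insertFixed {n : ℕ} (t : Fin (n + 1)) (σ : Perm (Fin n)) :
    zPerm (insertFixed t σ) = zPerm σ + 1 := by
  have h1 := zPerm_add_sum_cycleType σ
  have h2 := zPerm_add_sum_cycleType (insertFixed t σ)
  rw [cycleType_insertFixed] at h2
  omega

end zPerm

section weakDescents

/-- The number of points `i` with `σ i ≤ i`. -/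
def weakDescents {n : ℕ} (σ : Perm (Fin n)) : ℕ :=
  (Finset.univ.filter fun i => σ i ≤ i).card

lemma weakDescents_insertFixed {n : ℕ} (t : Fin (n + 1)) (σ : Perm (Fin n)) :
    weakDescents (insertFixed t σ) = weakDescents σ + 1 := by
  simp only [weakDescents, Finset.card_filter]
  rw [Fin.sum_univ_succAbove _ t]
  simp [add_comm]

lemma weakDescents_add {n : ℕ} (hn : 1 ≤ n) (α : Perm (Fin n)) :
    weakDescents α + weakDescents (α⁻¹ * finRotate n) = n + 1 := by
  obtain ⟨n, rfl⟩ : ∃ m, n = m + 1 := ⟨n - 1, by omega⟩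
  have h1 : weakDescents α =
      ∑ i, if finRotate (n + 1) i ≤ (α⁻¹ * finRotate (n + 1)) i then 1 else 0 := by
    rw [weakDescents, Finset.card_filter]
    refine (Fintype.sum_equiv (α⁻¹ * finRotate (n + 1)) _ _ fun i => ?_).symm
    simp
  rw [h1, weakDescents, Finset.card_filter, ← Finset.sum_add_distrib, Fin.sum_univ_castSucc]
  have h2 : ∀ i : Fin n, ((if finRotate (n + 1) i.castSucc ≤
      (α⁻¹ * finRotate (n + 1)) i.castSucc then 1 else 0) +
      if (α⁻¹ * finRotate (n + 1)) i.castSucc ≤ i.castSucc then 1 else 0) = 1 := by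
    intro i
    generalize (α⁻¹ * finRotate (n + 1)) i.castSucc = j
    have := i.isLt
    simp only [Fin.le_def, val_finRotate, Fin.val_castSucc]
    split_ifs <;> omega
  rw [Finset.sum_congr rfl fun i _ => h2 i]
  simp [Fin.le_last]

/-- The set of smallest elements of the cycles of a permutation. -/
def cycleMinima {n : ℕ} (σ : Perm (Fin n)) : Set (Fin n) :=
  {i | ∀ j, σ.SameCycle i j → i ≤ j}

lemma exists_cycleMinima {n : ℕ} (σ : Perm (Fin n)) (x : Fin n) :
    ∃ i ∈ cycleMinima σ, σ.SameCycle x i := by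
  obtain ⟨i, hi⟩ := (Set.toFinite {i | σ.SameCycle x i}).exists_minimal ⟨x, SameCycle.refl _ _⟩
  refine ⟨i, fun j hj => ?_, hi.1⟩
  exact (le_total i j).elim id fun h => hi.2 (hi.1.trans hj) h

lemma ncard_cycleMinima {n : ℕ} (σ : Perm (Fin n)) : (cycleMinima σ).ncard = zPerm σ := by
  rw [zPerm, ← Nat.card_coe_set_eq]
  refine Nat.card_eq_of_bijective
    (fun i : cycleMinima σ => (Quotient.mk (cycleSetoid σ) i.1)) ⟨?_, ?_⟩
  · intro i j hij
    have : σ.SameCycle i.1 j.1 := Quotient.exact hij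
    exact Subtype.ext (le_antisymm (i.2 _ this) (j.2 _ this.symm))
  · intro q
    induction q using Quotient.inductionOn' with
    | h x =>
      obtain ⟨i, hi, hx⟩ := exists_cycleMinima σ x
      exact ⟨⟨i, hi⟩, Quotient.sound hx.symm⟩

lemma isPartitionPerm_iff {n : ℕ} (σ : Perm (Fin n)) :
    IsPartitionPerm σ ↔ weakDescents σ = zPerm σ := by
  have hsub : σ ⁻¹' cycleMinima σ ⊆ {i | σ i ≤ i} := fun i hi =>
    hi i (SameCycle.refl σ i).apply_left
  have h1 : (σ ⁻¹' cycleMinima σ).ncard = zPerm σ := by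
    rw [← ncard_cycleMinima, Set.ncard_preimage_of_injective_subset_range σ.injective]
    simp
  have h2 : weakDescents σ = {i | σ i ≤ i}.ncard := by
    rw [weakDescents, ← Set.ncard_coe_finset]
    simp
  rw [h2, ← h1]
  have h3 : IsPartitionPerm σ ↔ {i | σ i ≤ i} ⊆ σ ⁻¹' cycleMinima σ := by
    constructor
    · intro h i hi j hj
      by_contra hlt
      rcases eq_or_lt_of_le (show σ i ≤ i from hi) with heq | hi
      · rw [heq] at hj hlt
        exact hlt (hj.eq_of_left heq).le
      · exact h i ⟨hi, j, (sameCycle_apply_left.1 hj), not_le.1 hlt⟩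
    · rintro h i ⟨hi, j, hj, hlt⟩
      exact absurd (h hi.le j (sameCycle_apply_left.2 hj)) (not_le.2 hlt)
  rw [h3]
  constructor
  · intro h
    rw [h.antisymm hsub]
  · intro h
    exact (Set.eq_of_subset_of_ncard_le hsub h.le).ge

lemma zPerm_add_weakDescents_le {n : ℕ} (σ : Perm (Fin n)) (hσ : ∀ i, σ i ≠ i) :
    zPerm σ + weakDescents σ ≤ n := by
  have h1 : zPerm σ ≤ (Finset.univ.filter fun i => ¬ σ i ≤ i).card := by
    rw [← ncard_cycleMinima, ← Set.ncard_coe_finset]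
    refine Set.ncard_le_ncard (fun i hi => ?_)
    simpa using lt_of_le_of_ne (hi _ (SameCycle.refl σ i).apply_right) (hσ i).symm
  have h2 := Finset.card_filter_add_card_filter_not (s := Finset.univ) (fun i => σ i ≤ i)
  rw [Finset.card_univ, Fintype.card_fin] at h2
  rw [weakDescents]
  omega

end weakDescents

section transfer

variable {R : Type*} [CommRing R]

lemma sum_prod_path {ι : Type*} [Fintype ι] [DecidableEq ι] (M : Matrix ι ι R) (n : ℕ) (a c : ι) :
    ∑ g : Fin n → ι, ∏ i : Fin (n + 1),
      M (Fin.cons (α := fun _ => ι) a g i) (Fin.snoc (α := fun _ => ι) g c i) =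
        (M ^ (n + 1)) a c := by
  induction n generalizing a with
  | zero => simp [Fin.snoc]
  | succ n ih =>
    rw [pow_succ', Matrix.mul_apply, ← (Fin.consEquiv fun _ => ι).sum_comp, Fintype.sum_prod_type]
    refine Finset.sum_congr rfl fun e _ => ?_
    rw [← ih, Finset.mul_sum]
    refine Finset.sum_congr rfl fun g _ => ?_
    rw [Fin.prod_univ_succ]
    simp only [Fin.consEquiv, Equiv.coe_fn_mk, ← Fin.cons_snoc_eq_snoc_cons, Fin.cons_succ,
      Fin.cons_zero]

/-- Closed walks of length `n` are enumerated by the trace of the `n`-th power. -/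
lemma sum_prod_finRotate {ι : Type*} [Fintype ι] [DecidableEq ι] (M : Matrix ι ι R) (n : ℕ) :
    ∑ f : Fin (n + 1) → ι, ∏ i, M (f i) (f (finRotate (n + 1) i)) = (M ^ (n + 1)).trace := by
  rw [Matrix.trace, ← (Fin.consEquiv fun _ => ι).sum_comp, Fintype.sum_prod_type]
  refine Finset.sum_congr rfl fun a _ => ?_
  rw [Matrix.diag_apply, ← sum_prod_path]
  refine Finset.sum_congr rfl fun g _ => ?_
  rw [Fin.snoc_eq_cons_rotate]
  rfl

/-- Weights of the three letters: `0` for an unmarked point, `1` for a marked fixed point of `α`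
and `2` for a marked fixed point of `α⁻¹ ∘ ζ`. -/
def letterWeight (b w : R) : Fin 3 → R := ![(1 + b) * (1 + w), -b, -w]

/-- A cyclic word is admissible if no letter `2` is followed by a letter `1`. -/
def Admissible {n : ℕ} (f : Fin n → Fin 3) : Prop :=
  ∀ i, ¬ (f i = 2 ∧ f (finRotate n i) = 1)

instance {n : ℕ} (f : Fin n → Fin 3) : Decidable (Admissible f) :=
  inferInstanceAs (Decidable (∀ _, _))

lemma sum_admissible (b w : R) {n : ℕ} (hn : 1 ≤ n) :
    ∑ f : Fin n → Fin 3, (if Admissible f then ∏ i, letterWeight b w (f i) else 0) =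
      1 + (b * w) ^ n := by
  obtain ⟨n, rfl⟩ : ∃ m, n = m + 1 := ⟨n - 1, by omega⟩
  let M : Matrix (Fin 3) (Fin 3) R :=
    Matrix.of fun a c => if a = 2 ∧ c = 1 then 0 else letterWeight b w a
  have h1 : ∀ f : Fin (n + 1) → Fin 3,
      (if Admissible f then ∏ i, letterWeight b w (f i) else 0) =
        ∏ i, M (f i) (f (finRotate (n + 1) i)) := by
    intro f
    split_ifs with h
    · exact Finset.prod_congr rfl fun i _ => (if_neg (h i)).symm
    · simp only [Admissible, not_forall, not_not] at h
      obtain ⟨i, hi⟩ := h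
      have h0 : M (f i) (f (finRotate (n + 1) i)) = 0 := if_pos hi
      exact (Finset.prod_eq_zero (Finset.mem_univ i) h0).symm
  rw [Finset.sum_congr rfl fun f _ => h1 f, sum_prod_finRotate]
  have hM : M = !![(1 + b) * (1 + w), (1 + b) * (1 + w), (1 + b) * (1 + w);
      -b, -b, -b; -w, 0, -w] := by
    ext i j
    fin_cases i <;> fin_cases j <;> simp [M, letterWeight]
  have h3 : M ^ 3 = (1 + b * w) • M ^ 2 - (b * w) • M := by
    rw [hM]
    ext i j
    fin_cases i <;> fin_cases j <;>
      simp [pow_succ, Matrix.mul_apply, Fin.sum_univ_three] <;> ring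
  have ht1 : (M ^ 1).trace = 1 + (b * w) ^ 1 := by
    rw [hM]
    simp [Matrix.trace, Fin.sum_univ_three]
    ring
  have ht2 : (M ^ 2).trace = 1 + (b * w) ^ 2 := by
    rw [hM]
    simp [Matrix.trace, Fin.sum_univ_three, pow_succ]
    ring
  have key : ∀ m, (M ^ (m + 1)).trace = 1 + (b * w) ^ (m + 1) ∧
      (M ^ (m + 2)).trace = 1 + (b * w) ^ (m + 2) := by
    intro m
    induction m with
    | zero => exact ⟨ht1, ht2⟩
    | succ m ih =>
      refine ⟨ih.2, ?_⟩
      have : M ^ (m + 1 + 2) = (1 + b * w) • M ^ (m + 2) - (b * w) • M ^ (m + 1) := by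
        rw [show m + 1 + 2 = m + 3 by ring, pow_add, h3, mul_sub, mul_smul_comm, mul_smul_comm,
          ← pow_add, ← pow_succ]
      rw [this, Matrix.trace_sub, Matrix.trace_smul, Matrix.trace_smul, ih.1, ih.2]
      simp only [smul_eq_mul]
      ring
  exact (key n).1

end transfer

section reduction

variable {R : Type*} [CommRing R]

/-- The permutations attached to genus-one partitions. -/
def IsGenusOnePartition {n : ℕ} (α : Perm (Fin n)) : Prop :=
  zPerm α + zPerm (α⁻¹ * finRotate n) + 1 = n ∧ weakDescents α = zPerm α

/-- Letter `1` prescribes a fixed point of `α`, letter `2` one of `α⁻¹ ∘ ζ`. -/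
def Compatible {n : ℕ} (f : Fin n → Fin 3) (α : Perm (Fin n)) : Prop :=
  ∀ i, (f i = 1 → α i = i) ∧ (f i = 2 → α i = finRotate n i)

/-- The weight `b ^ z(α) * w ^ (z(α⁻¹ ∘ ζ) + 1)`. -/
noncomputable def cycleWeight {n : ℕ} (b w : R) (α : Perm (Fin n)) : R :=
  b ^ zPerm α * w ^ (zPerm (α⁻¹ * finRotate n) + 1)

open Classical in
/-- The generating function of genus-one partitions compatible with the word `f`. -/
noncomputable def markedSum {n : ℕ} (b w : R) (f : Fin n → Fin 3) : R :=
  ∑ α : Perm (Fin n), if IsGenusOnePartition α ∧ Compatible f α then cycleWeight b w α else 0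

open Classical in
/-- The generating function of genus-one partitions. -/
noncomputable def genusOneSum (b w : R) (n : ℕ) : R :=
  ∑ α : Perm (Fin n), if IsGenusOnePartition α then cycleWeight b w α else 0

lemma zPerm_conj {n : ℕ} (σ τ : Perm (Fin n)) : zPerm (τ * σ * τ⁻¹) = zPerm σ := by
  have h1 := zPerm_add_sum_cycleType σ
  have h2 := zPerm_add_sum_cycleType (τ * σ * τ⁻¹)
  rw [cycleType_conj] at h2
  omega

lemma zPerm_mul_comm {n : ℕ} (σ τ : Perm (Fin n)) : zPerm (τ * σ) = zPerm (σ * τ) := by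
  rw [← zPerm_conj (σ * τ) τ]
  group

lemma zPerm_inv_insertFixed_mul_finRotate {n : ℕ} (hn : 1 ≤ n) (t : Fin (n + 1))
    (σ : Perm (Fin n)) :
    zPerm ((insertFixed t σ)⁻¹ * finRotate (n + 1)) = zPerm (σ⁻¹ * finRotate n) := by
  rw [zPerm_mul_comm, finRotate_succ_eq_swap_mul t, ← insertFixed_inv, mul_assoc,
    ← insertFixed_mul, zPerm_swap_mul_insertFixed _ _ (finRotate_ne_self (by omega) t),
    zPerm_mul_comm]

lemma isGenusOnePartition_insertFixed {n : ℕ} (hn : 1 ≤ n) (t : Fin (n + 1))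
    (σ : Perm (Fin n)) :
    IsGenusOnePartition (insertFixed t σ) ↔ IsGenusOnePartition σ := by
  rw [IsGenusOnePartition, IsGenusOnePartition, zPerm_inv_insertFixed_mul_finRotate hn,
    zPerm_insertFixed, weakDescents_insertFixed]
  omega

lemma cycleWeight_insertFixed {n : ℕ} (hn : 1 ≤ n) (b w : R) (t : Fin (n + 1))
    (σ : Perm (Fin n)) :
    cycleWeight b w (insertFixed t σ) = b * cycleWeight b w σ := by
  rw [cycleWeight, cycleWeight, zPerm_inv_insertFixed_mul_finRotate hn, zPerm_insertFixed]
  ring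

/-- Insert `t` as a fixed point of `α⁻¹ ∘ ζ`. -/
def insertCofixed {n : ℕ} (t : Fin (n + 1)) (σ : Perm (Fin n)) : Perm (Fin (n + 1)) :=
  finRotate (n + 1) * (insertFixed t (σ⁻¹ * finRotate n))⁻¹

lemma inv_insertCofixed_mul_finRotate {n : ℕ} (t : Fin (n + 1)) (σ : Perm (Fin n)) :
    (insertCofixed t σ)⁻¹ * finRotate (n + 1) = insertFixed t (σ⁻¹ * finRotate n) := by
  rw [insertCofixed]
  group

lemma zPerm_insertCofixed {n : ℕ} (hn : 1 ≤ n) (t : Fin (n + 1)) (σ : Perm (Fin n)) :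
    zPerm (insertCofixed t σ) = zPerm σ := by
  have h := zPerm_inv_insertFixed_mul_finRotate hn t (σ⁻¹ * finRotate n)
  rw [zPerm_mul_comm] at h
  rw [insertCofixed, h, ← zPerm_conj σ (finRotate n)⁻¹]
  group

lemma weakDescents_insertCofixed {n : ℕ} (hn : 1 ≤ n) (t : Fin (n + 1)) (σ : Perm (Fin n)) :
    weakDescents (insertCofixed t σ) = weakDescents σ := by
  have h1 := weakDescents_add hn σ
  have h2 := weakDescents_add (by omega) (insertCofixed t σ)
  rw [inv_insertCofixed_mul_finRotate, weakDescents_insertFixed] at h2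
  omega

lemma isGenusOnePartition_insertCofixed {n : ℕ} (hn : 1 ≤ n) (t : Fin (n + 1))
    (σ : Perm (Fin n)) :
    IsGenusOnePartition (insertCofixed t σ) ↔ IsGenusOnePartition σ := by
  rw [IsGenusOnePartition, IsGenusOnePartition, inv_insertCofixed_mul_finRotate,
    zPerm_insertCofixed hn, zPerm_insertFixed, weakDescents_insertCofixed hn]
  omega

lemma cycleWeight_insertCofixed {n : ℕ} (hn : 1 ≤ n) (b w : R) (t : Fin (n + 1))
    (σ : Perm (Fin n)) :
    cycleWeight b w (insertCofixed t σ) = w * cycleWeight b w σ := by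
  rw [cycleWeight, cycleWeight, inv_insertCofixed_mul_finRotate, zPerm_insertFixed,
    zPerm_insertCofixed hn]
  ring

lemma insertCofixed_injective {n : ℕ} (t : Fin (n + 1)) :
    Function.Injective (insertCofixed t) := fun σ τ h => by
  have := insertFixed_injective t (inv_injective (mul_left_cancel h))
  simpa using this

lemma exists_insertCofixed_eq {n : ℕ} {t : Fin (n + 1)} {α : Perm (Fin (n + 1))}
    (h : α t = finRotate (n + 1) t) : ∃ σ, insertCofixed t σ = α := by
  obtain ⟨τ, hτ⟩ := exists_insertFixed_eq (t := t) (α := α⁻¹ * finRotate (n + 1))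
    (by rw [mul_apply, inv_eq_iff_eq, h])
  refine ⟨finRotate n * τ⁻¹, ?_⟩
  rw [insertCofixed, show (finRotate n * τ⁻¹)⁻¹ * finRotate n = τ by group, hτ]
  group

lemma insertCofixed_self {n : ℕ} (t : Fin (n + 1)) (σ : Perm (Fin n)) :
    insertCofixed t σ t = finRotate (n + 1) t := by
  rw [insertCofixed, mul_apply, inv_eq_iff_eq.2 (insertFixed_self t _).symm]

lemma insertCofixed_succAbove {n : ℕ} (t : Fin (n + 1)) (σ : Perm (Fin n)) (y : Fin n) :
    insertCofixed t σ (t.succAbove y) =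
      finRotate (n + 1) (t.succAbove ((finRotate n)⁻¹ (σ y))) := by
  rw [insertCofixed, ← insertFixed_inv, mul_apply, insertFixed_succAbove]
  simp

lemma compatible_insertFixed {n : ℕ} (t : Fin (n + 1)) (f : Fin (n + 1) → Fin 3)
    (ht : f t = 1) (hpred : ∀ i, finRotate (n + 1) i = t → f i ≠ 2) (σ : Perm (Fin n)) :
    Compatible f (insertFixed t σ) ↔ Compatible (f ∘ t.succAbove) σ := by
  rw [Compatible, Fin.forall_iff_succAbove t, Compatible]
  simp only [insertFixed_self, ht, insertFixed_succAbove, Function.comp_apply]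
  refine ⟨fun h y => ⟨fun hy => ?_, fun hy => ?_⟩, fun h => ⟨by simp, fun y => ⟨fun hy => ?_,
    fun hy => ?_⟩⟩⟩
  · exact Fin.succAbove_right_injective ((h.2 y).1 hy)
  · have h1 := (h.2 y).2 hy
    rw [finRotate_succAbove_of_ne t y fun h => hpred _ h hy] at h1
    exact Fin.succAbove_right_injective h1
  · rw [(h y).1 hy]
  · rw [(h y).2 hy, finRotate_succAbove_of_ne t y fun h => hpred _ h hy]

lemma compatible_insertCofixed {n : ℕ} (t : Fin (n + 1)) (f : Fin (n + 1) → Fin 3)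
    (ht : f t = 2) (hsucc : f (finRotate (n + 1) t) ≠ 1) (σ : Perm (Fin n)) :
    Compatible f (insertCofixed t σ) ↔ Compatible (f ∘ t.succAbove) σ := by
  have key : ∀ y, f (t.succAbove y) = 1 → (finRotate (n + 1) (t.succAbove ((finRotate n)⁻¹ (σ y)))
      = t.succAbove y ↔ σ y = y) := by
    intro y hy
    by_cases hc : finRotate (n + 1) (t.succAbove ((finRotate n)⁻¹ (σ y))) = t
    · rw [hc]
      have h2 := succAbove_finRotate_of_eq t _ hc
      rw [← mul_apply, mul_inv_cancel, one_apply] at h2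
      refine iff_of_false (Fin.ne_succAbove t y) fun h => ?_
      rw [← h2, h] at hsucc
      exact hsucc hy
    · rw [finRotate_succAbove_of_ne t _ hc, ← mul_apply, mul_inv_cancel, one_apply]
      exact Fin.succAbove_right_injective.eq_iff
  rw [Compatible, Fin.forall_iff_succAbove t, Compatible]
  simp only [insertCofixed_self, ht, insertCofixed_succAbove, Function.comp_apply,
    (finRotate (n + 1)).injective.eq_iff, Fin.succAbove_right_injective.eq_iff, inv_eq_iff_eq]
  refine ⟨fun h y => ⟨fun hy => (key y hy).1 ((h.2 y).1 hy), (h.2 y).2⟩,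
    fun h => ⟨by simp, fun y => ⟨fun hy => (key y hy).2 ((h y).1 hy), (h y).2⟩⟩⟩

lemma admissible_comp_succAbove {n : ℕ} (t : Fin (n + 1)) (f : Fin (n + 1) → Fin 3)
    (h : (f t = 1 ∧ ∀ i, finRotate (n + 1) i = t → f i ≠ 2) ∨
      (f t = 2 ∧ f (finRotate (n + 1) t) ≠ 1)) :
    Admissible (f ∘ t.succAbove) ↔ Admissible f := by
  rw [Admissible, Admissible, Fin.forall_iff_succAbove t (P := fun i => ¬ (f i = 2 ∧ _))]
  have h0 : ¬ (f t = 2 ∧ f (finRotate (n + 1) t) = 1) := by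
    rcases h with h | h
    · exact fun h' => by simp [h.1] at h'
    · exact fun h' => h.2 h'.2
  rw [and_iff_right h0]
  refine forall_congr' fun y => not_congr (and_congr_right fun hy => ?_)
  simp only [Function.comp_apply] at hy ⊢
  by_cases hc : finRotate (n + 1) (t.succAbove y) = t
  · rcases h with h | h
    · exact absurd hy (h.2 _ hc)
    · rw [succAbove_finRotate_of_eq t y hc, hc, h.1]
      exact iff_of_false h.2 (by decide)
  · rw [finRotate_succAbove_of_ne t y hc]

lemma markedSum_of_not_admissible {n : ℕ} (hn : 2 ≤ n) (b w : R) (f : Fin n → Fin 3)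
    (hf : ¬ Admissible f) : markedSum b w f = 0 := by
  simp only [Admissible, not_forall, not_not] at hf
  obtain ⟨i, h2, h1⟩ := hf
  refine Finset.sum_eq_zero fun α _ => if_neg fun h => ?_
  exact finRotate_ne_self hn i (α.injective (((h.2 _).1 h1).trans ((h.2 _).2 h2).symm))

lemma markedSum_of_black {n : ℕ} (hn : 1 ≤ n) (b w : R) (t : Fin (n + 1))
    (f : Fin (n + 1) → Fin 3) (ht : f t = 1) (hpred : ∀ i, finRotate (n + 1) i = t → f i ≠ 2) :
    markedSum b w f = b * markedSum b w (f ∘ t.succAbove) := by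
  classical
  rw [markedSum, markedSum, Finset.mul_sum]
  refine (Finset.sum_of_injOn (insertFixed t) (insertFixed_injective t).injOn (by simp)
    (fun α _ hα => if_neg fun h => hα ?_) fun σ _ => ?_).symm
  · obtain ⟨σ, rfl⟩ := exists_insertFixed_eq ((h.2 t).1 ht)
    exact ⟨σ, by simp, rfl⟩
  · rw [isGenusOnePartition_insertFixed hn, compatible_insertFixed t f ht hpred,
      cycleWeight_insertFixed hn, mul_ite, mul_zero]

lemma markedSum_of_white {n : ℕ} (hn : 1 ≤ n) (b w : R) (t : Fin (n + 1))
    (f : Fin (n + 1) → Fin 3) (ht : f t = 2) (hsucc : f (finRotate (n + 1) t) ≠ 1) :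
    markedSum b w f = w * markedSum b w (f ∘ t.succAbove) := by
  classical
  rw [markedSum, markedSum, Finset.mul_sum]
  refine (Finset.sum_of_injOn (insertCofixed t) (insertCofixed_injective t).injOn (by simp)
    (fun α _ hα => if_neg fun h => hα ?_) fun σ _ => ?_).symm
  · obtain ⟨σ, rfl⟩ := exists_insertCofixed_eq ((h.2 t).2 ht)
    exact ⟨σ, by simp, rfl⟩
  · rw [isGenusOnePartition_insertCofixed hn, compatible_insertCofixed t f ht hsucc,
      cycleWeight_insertCofixed hn, mul_ite, mul_zero]

lemma not_isGenusOnePartition_of_lt {n : ℕ} (hn : n < 2) (α : Perm (Fin n)) :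
    ¬ IsGenusOnePartition α := by
  intro h
  have h1 := zPerm_add_sum_cycleType α
  have : Subsingleton (Fin n) := Fin.subsingleton_iff_le_one.2 (by omega)
  have h3 := h.1
  rw [Subsingleton.elim (α⁻¹ * finRotate n) 1] at h3
  rw [Subsingleton.elim α 1] at h1 h3
  simp at h1
  omega

lemma genusOneSum_of_lt (b w : R) {n : ℕ} (hn : n < 2) : genusOneSum b w n = 0 :=
  Finset.sum_eq_zero fun α _ => if_neg (not_isGenusOnePartition_of_lt hn α)

lemma markedSum_eq (b w : R) {n : ℕ} (hn : 2 ≤ n) (f : Fin n → Fin 3) :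
    markedSum b w f = if Admissible f then
      (∏ i, ![1, b, w] (f i)) * genusOneSum b w (Finset.univ.filter fun i => f i = 0).card
      else 0 := by
  classical
  split_ifs with hf
  swap
  · exact markedSum_of_not_admissible hn b w f hf
  clear hn
  induction n with
  | zero =>
    simp [markedSum, genusOneSum, not_isGenusOnePartition_of_lt]
  | succ n ih =>
    by_cases h0 : ∀ i, f i = 0
    · obtain rfl : f = fun _ => 0 := funext h0
      have h1 : ∀ α : Perm (Fin (n + 1)), Compatible (fun _ => 0) α := fun α i => by simp
      have h2 : markedSum b w (fun _ : Fin (n + 1) => 0) = genusOneSum b w (n + 1) :=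
        Finset.sum_congr rfl fun α _ => if_congr (and_iff_left (h1 α)) rfl rfl
      rw [h2]
      simp
    · push Not at h0
      obtain ⟨t, ht⟩ := h0
      rcases Nat.eq_zero_or_pos n with rfl | hn
      · have : (Finset.univ.filter fun i => f i = 0).card < 2 :=
          (Finset.card_le_univ _).trans_lt (by simp)
        rw [genusOneSum_of_lt _ _ this, markedSum]
        simp [not_isGenusOnePartition_of_lt]
      have hcard : (Finset.univ.filter fun i => f i = 0).card =
          (Finset.univ.filter fun i => (f ∘ t.succAbove) i = 0).card := by
        simp only [Finset.card_filter]
        rw [Fin.sum_univ_succAbove _ t, if_neg ht, zero_add]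
        rfl
      rw [Fin.prod_univ_succAbove _ t, hcard]
      have h12 : f t = 1 ∨ f t = 2 := by omega
      rcases h12 with h1 | h2
      · have hpred : ∀ i, finRotate (n + 1) i = t → f i ≠ 2 := fun i hi h2 =>
          hf i ⟨h2, hi ▸ h1⟩
        rw [markedSum_of_black hn b w t f h1 hpred,
          ih _ ((admissible_comp_succAbove t f (.inl ⟨h1, hpred⟩)).2 hf), h1]
        simp [mul_assoc]
      · have hsucc : f (finRotate (n + 1) t) ≠ 1 := fun h1 => hf t ⟨h2, h1⟩
        rw [markedSum_of_white hn b w t f h2 hsucc,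
          ih _ ((admissible_comp_succAbove t f (.inr ⟨h2, hsucc⟩)).2 hf), h2]
        simp [mul_assoc]

open Classical in
/-- The generating function of genus-one partitions such that neither `α` nor `α⁻¹ ∘ ζ` has fixed
points. -/
noncomputable def coreSum (b w : R) (n : ℕ) : R :=
  ∑ α : Perm (Fin n), if IsGenusOnePartition α ∧ ∀ i, α i ≠ i ∧ α i ≠ finRotate n i
    then cycleWeight b w α else 0

/-- Inclusion-exclusion over the fixed points of `α` and `α⁻¹ ∘ ζ`. -/
lemma coreSum_eq (b w : R) {n : ℕ} (hn : 2 ≤ n) :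
    coreSum b w n = ∑ f : Fin n → Fin 3, if Admissible f then
      (∏ i, ![1, -b, -w] (f i)) * genusOneSum b w (Finset.univ.filter fun i => f i = 0).card
      else 0 := by
  classical
  have h1 : ∀ α : Perm (Fin n), (if ∀ i, α i ≠ i ∧ α i ≠ finRotate n i then (1 : R) else 0) =
      ∑ f : Fin n → Fin 3, if Compatible f α then ∏ i, ![1, -1, -1] (f i) else 0 := by
    intro α
    have h2 : ∀ i, (if α i ≠ i ∧ α i ≠ finRotate n i then (1 : R) else 0) =
        ∑ c : Fin 3, if (c = 1 → α i = i) ∧ (c = 2 → α i = finRotate n i)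
          then ![1, -1, -1] c else 0 := by
      intro i
      have := finRotate_ne_self hn i
      generalize finRotate n i = j at this
      rw [Fin.sum_univ_three]
      by_cases h3 : α i = i
      · simp [h3, this.symm]
      · by_cases h4 : α i = j
        · simp [h4, this]
        · simp [h3, h4]
    have h3 := Fintype.prod_ite_zero (p := fun i => α i ≠ i ∧ α i ≠ finRotate n i)
      (f := fun _ => (1 : R))
    rw [Finset.prod_const_one] at h3
    refine Eq.trans (by congr) (h3.symm.trans ?_)
    rw [Finset.prod_congr rfl fun i _ => h2 i, Finset.prod_univ_sum, Fintype.piFinset_univ]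
    refine Finset.sum_congr rfl fun f _ => ?_
    rw [Fintype.prod_ite_zero]
    congr
  have h2 : coreSum b w n = ∑ f : Fin n → Fin 3, (∏ i, ![1, -1, -1] (f i)) * markedSum b w f := by
    simp only [markedSum, Finset.mul_sum]
    rw [Finset.sum_comm]
    refine Finset.sum_congr rfl fun α _ => ?_
    by_cases hα : IsGenusOnePartition α
    · have := congrArg (· * cycleWeight b w α) (h1 α)
      simp only [Finset.sum_mul, ite_mul, one_mul, zero_mul] at this
      simpa [hα] using this
    · simp [hα]
  rw [h2]
  refine Finset.sum_congr rfl fun f _ => ?_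
  rw [markedSum_eq b w hn, mul_ite, mul_zero, ← mul_assoc, ← Finset.prod_mul_distrib]
  congr 3
  funext i
  generalize f i = c
  fin_cases c <;> simp

end reduction

section cycleType

variable {n : ℕ}

lemma sum_cycleType_eq_iff (σ : Perm (Fin n)) : σ.cycleType.sum = n ↔ ∀ i, σ i ≠ i := by
  rw [sum_cycleType]
  conv_lhs => rhs; rw [← Fintype.card_fin n]
  rw [Finset.card_eq_iff_eq_univ, Finset.eq_univ_iff_forall]
  simp

lemma zPerm_eq_card_cycleType {σ : Perm (Fin n)} (h : ∀ i, σ i ≠ i) :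
    zPerm σ = σ.cycleType.card := by
  have h1 := zPerm_add_sum_cycleType σ
  have h2 := (sum_cycleType_eq_iff σ).2 h
  omega

lemma sum_cycleType_ge (σ : Perm (Fin n)) : 2 * σ.cycleType.card ≤ σ.cycleType.sum := by
  have := Multiset.card_nsmul_le_sum (s := σ.cycleType) fun c hc => two_le_of_mem_cycleType hc
  rwa [smul_eq_mul, mul_comm] at this

lemma cycleType_eq_replicate_of_pow {σ : Perm (Fin n)} {p a : ℕ} [hp : Fact p.Prime]
    (h1 : σ ^ p = 1) (h2 : ∀ i, σ i ≠ i) (hn : n = a * p) :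
    σ.cycleType = Multiset.replicate a p := by
  have h3 := pow_prime_eq_one_iff.1 h1
  have h4 := (sum_cycleType_eq_iff σ).2 h2
  rw [Multiset.eq_replicate_card.2 h3, Multiset.sum_replicate, smul_eq_mul] at h4
  rw [Multiset.eq_replicate_card.2 h3, Nat.eq_of_mul_eq_mul_right hp.1.pos (h4.trans hn)]

lemma eq_replicate_two_of_sum_eq {m : Multiset ℕ} (h : ∀ c ∈ m, 2 ≤ c)
    (hs : m.sum = 2 * m.card) : m = Multiset.replicate m.card 2 := by
  rw [Multiset.eq_replicate]
  refine ⟨rfl, fun c hc => ?_⟩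
  obtain ⟨m, rfl⟩ := Multiset.exists_cons_of_mem hc
  have h1 := h c hc
  have h2 := Multiset.card_nsmul_le_sum (s := m) fun d hd => h d (Multiset.mem_cons_of_mem hd)
  rw [Multiset.sum_cons, Multiset.card_cons] at hs
  rw [smul_eq_mul] at h2
  omega

lemma eq_three_cons_replicate_two {m : Multiset ℕ} (h : ∀ c ∈ m, 2 ≤ c)
    (hs : m.sum = 2 * m.card + 1) : ∃ r, m = {3} + Multiset.replicate r 2 := by
  induction m using Multiset.induction_on with
  | empty => simp at hs
  | cons c m ih =>
    have h1 := h c (Multiset.mem_cons_self c m)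
    have h2 : ∀ d ∈ m, 2 ≤ d := fun d hd => h d (Multiset.mem_cons_of_mem hd)
    have h3 := Multiset.card_nsmul_le_sum h2
    rw [Multiset.sum_cons, Multiset.card_cons] at hs
    rw [smul_eq_mul] at h3
    obtain rfl | rfl : c = 2 ∨ c = 3 := by omega
    · obtain ⟨r, hr⟩ := ih h2 (by omega)
      exact ⟨r + 1, by rw [hr, Multiset.replicate_succ, ← Multiset.add_cons]⟩
    · exact ⟨m.card, by rw [← eq_replicate_two_of_sum_eq h2 (by omega)]; rfl⟩

lemma eq_cons_replicate_two {m : Multiset ℕ} (h : ∀ c ∈ m, 2 ≤ c)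
    (hs : m.sum = 2 * m.card + 2) :
    (∃ r, m = {4} + Multiset.replicate r 2) ∨ ∃ r, m = {3, 3} + Multiset.replicate r 2 := by
  induction m using Multiset.induction_on with
  | empty => simp at hs
  | cons c m ih =>
    have h1 := h c (Multiset.mem_cons_self c m)
    have h2 : ∀ d ∈ m, 2 ≤ d := fun d hd => h d (Multiset.mem_cons_of_mem hd)
    have h3 := Multiset.card_nsmul_le_sum h2
    rw [Multiset.sum_cons, Multiset.card_cons] at hs
    rw [smul_eq_mul] at h3
    obtain rfl | rfl | rfl : c = 2 ∨ c = 3 ∨ c = 4 := by omega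
    · refine (ih h2 (by omega)).imp ?_ ?_ <;>
      · rintro ⟨r, hr⟩
        exact ⟨r + 1, by rw [hr, Multiset.replicate_succ, ← Multiset.add_cons]⟩
    · obtain ⟨r, rfl⟩ := eq_three_cons_replicate_two h2 (by omega)
      exact .inr ⟨r, rfl⟩
    · exact .inl ⟨m.card, by rw [← eq_replicate_two_of_sum_eq h2 (by omega)]; rfl⟩

lemma weakDescents_of_involutive {σ : Perm (Fin n)} (h : Function.Involutive σ)
    (h0 : ∀ i, σ i ≠ i) : 2 * weakDescents σ = n := by
  have h1 : weakDescents σ = (Finset.univ.filter fun i => ¬ σ i ≤ i).card := by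
    refine Finset.card_bij (fun i _ => σ i) (fun i hi => ?_) (fun i _ j _ hij => σ.injective hij)
      fun i hi => ⟨σ i, ?_, h i⟩
    · have := lt_of_le_of_ne (by simpa using hi) (h0 i)
      simpa [h i] using this
    · simp only [Finset.mem_filter, Finset.mem_univ, true_and, not_le, h i] at hi ⊢
      exact hi.le
  have h2 := Finset.card_filter_add_card_filter_not (s := Finset.univ) fun i => σ i ≤ i
  rw [← h1, Finset.card_univ, Fintype.card_fin] at h2
  change weakDescents σ + weakDescents σ = n at h2
  omega

/-- Fixed-point-free involutions `α` such that `α⁻¹ ∘ ζ` has `r` two-cycles besides the cycles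
prescribed by `μ`. -/
def pairings (μ : Multiset ℕ) (a r n : ℕ) : Finset (Perm (Fin n)) :=
  Finset.univ.filter fun α => α.cycleType = Multiset.replicate a 2 ∧
    (α⁻¹ * finRotate n).cycleType = μ + Multiset.replicate r 2

lemma inv_mul_finRotate_ne_iff (α : Perm (Fin n)) (i : Fin n) :
    (α⁻¹ * finRotate n) i ≠ i ↔ α i ≠ finRotate n i := by
  rw [mul_apply, Ne, inv_eq_iff_eq, eq_comm]

lemma core_eq_two_mul {α : Perm (Fin n)} (h : IsGenusOnePartition α)
    (h0 : ∀ i, α i ≠ i ∧ α i ≠ finRotate n i) :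
    n = 2 * zPerm α ∧ zPerm (α⁻¹ * finRotate n) + 1 = zPerm α := by
  have h1 := sum_cycleType_ge α
  rw [← zPerm_eq_card_cycleType fun i => (h0 i).1,
    (sum_cycleType_eq_iff α).2 fun i => (h0 i).1] at h1
  have h2 := zPerm_add_weakDescents_le (α⁻¹ * finRotate n) fun i =>
    (inv_mul_finRotate_ne_iff α i).2 (h0 i).2
  have h3 := weakDescents_add (by have := h.1; omega) α
  obtain ⟨h4, h5⟩ := h
  omega

lemma isGenusOnePartition_and_iff {s : ℕ} (α : Perm (Fin (2 * s))) :
    (IsGenusOnePartition α ∧ ∀ i, α i ≠ i ∧ α i ≠ finRotate (2 * s) i) ↔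
      (∃ r, s = r + 2 ∧ α ∈ pairings {4} s r (2 * s)) ∨
        ∃ r, s = r + 3 ∧ α ∈ pairings {3, 3} s r (2 * s) := by
  constructor
  · rintro ⟨h, h0⟩
    obtain ⟨h1, h2⟩ := core_eq_two_mul h h0
    have f1 : ∀ i, α i ≠ i := fun i => (h0 i).1
    have f2 : ∀ i, (α⁻¹ * finRotate (2 * s)) i ≠ i := fun i =>
      (inv_mul_finRotate_ne_iff α i).2 (h0 i).2
    have s1 := (sum_cycleType_eq_iff _).2 f1
    have s2 := (sum_cycleType_eq_iff _).2 f2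
    have c1 := zPerm_eq_card_cycleType f1
    have c2 := zPerm_eq_card_cycleType f2
    have hα := eq_replicate_two_of_sum_eq (m := α.cycleType)
      (fun c hc => two_le_of_mem_cycleType hc) (by omega)
    rw [show α.cycleType.card = s by omega] at hα
    refine (eq_cons_replicate_two (m := (α⁻¹ * finRotate (2 * s)).cycleType)
      (fun c hc => two_le_of_mem_cycleType hc) (by omega)).imp ?_ ?_ <;>
    · rintro ⟨r, hr⟩
      refine ⟨r, ?_, by simp only [pairings, Finset.mem_filter, Finset.mem_univ, hα, hr]; simp⟩
      rw [hr] at s2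
      simp at s2
      omega
  · intro h
    obtain ⟨hα, f2, c2⟩ : α.cycleType = Multiset.replicate s 2 ∧
        (∀ i, (α⁻¹ * finRotate (2 * s)) i ≠ i) ∧ zPerm (α⁻¹ * finRotate (2 * s)) + 1 = s := by
      rcases h with ⟨r, rfl, h⟩ | ⟨r, rfl, h⟩ <;>
      · rw [pairings, Finset.mem_filter] at h
        have f2 := (sum_cycleType_eq_iff (α⁻¹ * finRotate _)).1 (by rw [h.2.2]; simp; ring)
        refine ⟨h.2.1, f2, ?_⟩
        rw [zPerm_eq_card_cycleType f2, h.2.2]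
        simp
    have f1 := (sum_cycleType_eq_iff α).1 (by rw [hα]; simp [mul_comm])
    have c1 : zPerm α = s := by rw [zPerm_eq_card_cycleType f1, hα, Multiset.card_replicate]
    have hi : α ^ 2 = 1 := pow_prime_eq_one_iff.2 fun c hc => by
      rw [hα] at hc
      exact Multiset.eq_of_mem_replicate hc
    have hw := weakDescents_of_involutive (σ := α)
      (fun i => by rw [← mul_apply, ← pow_two, hi, one_apply]) f1
    exact ⟨⟨by omega, by omega⟩, fun i => ⟨f1 i, (inv_mul_finRotate_ne_iff α i).1 (f2 i)⟩⟩

end cycleType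

section doubleCount

variable {n : ℕ}

/-- The points on two-cycles. -/
lemma card_filter_apply_apply {σ : Perm (Fin n)} (h : ∀ i, σ i ≠ i) :
    (Finset.univ.filter fun y => σ (σ y) = y).card = 2 * σ.cycleType.count 2 := by
  have h1 : (Finset.univ.filter fun y => σ (σ y) = y) =
      (σ.cycleFactorsFinset.filter fun c => 2 = c.support.card).biUnion support := by
    ext y
    simp only [Finset.mem_filter, Finset.mem_univ, true_and, Finset.mem_biUnion]
    constructor
    · intro hy
      refine ⟨σ.cycleOf y, ⟨cycleOf_mem_cycleFactorsFinset_iff.2 (by simpa using h y), ?_⟩, ?_⟩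
      · have hc := isCycle_cycleOf σ (h y)
        have h2 : σ.cycleOf y ^ 2 = 1 := hc.pow_eq_one_iff.2 ⟨y, by simpa using h y, by
          rw [cycleOf_pow_apply_self, pow_two, mul_apply, hy]⟩
        have h3 := orderOf_dvd_of_pow_eq_one h2
        rw [hc.orderOf] at h3
        exact le_antisymm hc.two_le_card_support (Nat.le_of_dvd two_pos h3)
      · rw [mem_support, cycleOf_apply_self]
        exact h y
    · rintro ⟨c, ⟨hc, h2⟩, hy⟩
      obtain ⟨hc, hcy⟩ := mem_cycleFactorsFinset_iff.1 hc
      rw [← hcy y hy, ← hcy _ (apply_mem_support.2 hy), ← mul_apply, ← pow_two, h2, ← hc.orderOf,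
        pow_orderOf_eq_one, one_apply]
  rw [h1, Finset.card_biUnion, Finset.sum_const_nat (m := 2), cycleType_def,
    Multiset.count_map, mul_comm]
  · rfl
  · intro c hc
    exact (Finset.mem_filter.1 hc).2.symm
  · intro c hc d hd hcd
    exact (cycleFactorsFinset_pairwise_disjoint σ (Finset.mem_filter.1 hc).1
      (Finset.mem_filter.1 hd).1 hcd).disjoint_support

lemma conj_mem_pairings {μ : Multiset ℕ} {a r : ℕ} (k : ℤ) {α : Perm (Fin n)}
    (h : α ∈ pairings μ a r n) :
    finRotate n ^ k * α * (finRotate n ^ k)⁻¹ ∈ pairings μ a r n := by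
  rw [pairings, Finset.mem_filter] at h ⊢
  have : (finRotate n ^ k * α * (finRotate n ^ k)⁻¹)⁻¹ * finRotate n =
      finRotate n ^ k * (α⁻¹ * finRotate n) * (finRotate n ^ k)⁻¹ := by group
  rw [this, cycleType_conj, cycleType_conj]
  exact ⟨Finset.mem_univ _, h.2⟩

lemma card_filter_pairings_eq (μ : Multiset ℕ) (a r : ℕ) (x y : Fin n) :
    ((pairings μ a r n).filter fun α =>
      (α⁻¹ * finRotate n) ((α⁻¹ * finRotate n) x) = x).card =
    ((pairings μ a r n).filter fun α =>
      (α⁻¹ * finRotate n) ((α⁻¹ * finRotate n) y) = y).card := by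
  wlog hle : ∀ x y : Fin n, ((pairings μ a r n).filter fun α =>
      (α⁻¹ * finRotate n) ((α⁻¹ * finRotate n) x) = x).card ≤
    ((pairings μ a r n).filter fun α =>
      (α⁻¹ * finRotate n) ((α⁻¹ * finRotate n) y) = y).card
  · refine absurd (fun x y => ?_) hle
    obtain ⟨k, hk⟩ : ∃ k : ℤ, (finRotate n ^ k) x = y := by
      rcases lt_or_ge n 2 with hn | hn
      · have : Subsingleton (Fin n) := Fin.subsingleton_iff_le_one.2 (by omega)
        exact ⟨0, Subsingleton.elim _ _⟩
      · exact (isCycle_finRotate_of_le hn).exists_zpow_eq (finRotate_ne_self hn x)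
          (finRotate_ne_self hn y)
    refine Finset.card_le_card_of_injOn
      (fun α => finRotate n ^ k * α * (finRotate n ^ k)⁻¹) (fun α hα => ?_) fun α _ α' _ h => ?_
    · simp only [Finset.coe_filter, Set.mem_ofPred_eq] at hα ⊢
      have : (finRotate n ^ k * α * (finRotate n ^ k)⁻¹)⁻¹ * finRotate n =
          finRotate n ^ k * (α⁻¹ * finRotate n) * (finRotate n ^ k)⁻¹ := by group
      refine ⟨conj_mem_pairings k hα.1, ?_⟩
      rw [this, ← mul_apply, ← hk, ← mul_apply, show ∀ u v : Perm (Fin n),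
        u * v * u⁻¹ * (u * v * u⁻¹) * u = u * (v * v) from fun u v => by group, mul_apply,
        mul_apply, hα.2]
    · simpa using h
  exact (hle x y).antisymm (hle y x)

lemma two_mul_card_pairings {μ : Multiset ℕ} {a r : ℕ} (hμ : 2 ∉ μ) (hn : μ.sum + r * 2 = n)
    (x : Fin n) :
    2 * r * (pairings μ a r n).card = n * ((pairings μ a r n).filter fun α =>
      (α⁻¹ * finRotate n) ((α⁻¹ * finRotate n) x) = x).card := by
  have h1 : ∀ α ∈ pairings μ a r n, (Finset.univ.filter fun y =>
      (α⁻¹ * finRotate n) ((α⁻¹ * finRotate n) y) = y).card = 2 * r := by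
    intro α hα
    rw [pairings, Finset.mem_filter] at hα
    rw [card_filter_apply_apply, hα.2.2]
    · rw [Multiset.count_add, Multiset.count_eq_zero.2 hμ, Multiset.count_replicate_self, zero_add]
    · rw [← sum_cycleType_eq_iff, hα.2.2, ← hn]
      simp
  have h2 := Finset.sum_card_bipartiteAbove_eq_sum_card_bipartiteBelow
    (s := pairings μ a r n) (t := Finset.univ)
    (fun α y => (α⁻¹ * finRotate n) ((α⁻¹ * finRotate n) y) = y)
  simp only [Finset.bipartiteAbove, Finset.bipartiteBelow] at h2
  rw [Finset.sum_const_nat h1, Finset.sum_const_nat fun y _ => card_filter_pairings_eq μ a r y x,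
    Finset.card_univ, Fintype.card_fin] at h2
  rw [mul_comm, h2]

end doubleCount

section insertPair

variable {n : ℕ}

/-- Insert `0` and `j.succ` as fixed points. -/
def insertTwoFixed (j : Fin (n + 2)) (σ : Perm (Fin (n + 1))) : Perm (Fin (n + 3)) :=
  insertFixed 0 (insertFixed j σ)

@[simp] lemma insertTwoFixed_zero (j : Fin (n + 2)) (σ : Perm (Fin (n + 1))) :
    insertTwoFixed j σ 0 = 0 := insertFixed_self _ _

@[simp] lemma insertTwoFixed_succ (j : Fin (n + 2)) (σ : Perm (Fin (n + 1))) :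
    insertTwoFixed j σ j.succ = j.succ := by
  rw [insertTwoFixed, ← Fin.succAbove_zero, insertFixed_succAbove, insertFixed_self]

@[simp] lemma insertTwoFixed_succ_succAbove (j : Fin (n + 2)) (σ : Perm (Fin (n + 1)))
    (y : Fin (n + 1)) :
    insertTwoFixed j σ (j.succAbove y).succ = (j.succAbove (σ y)).succ := by
  rw [insertTwoFixed, ← Fin.succAbove_zero, insertFixed_succAbove, insertFixed_succAbove]

@[simp] lemma cycleType_insertTwoFixed (j : Fin (n + 2)) (σ : Perm (Fin (n + 1))) :
    (insertTwoFixed j σ).cycleType = σ.cycleType := by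
  rw [insertTwoFixed, cycleType_insertFixed, cycleType_insertFixed]

lemma exists_insertTwoFixed_eq {α : Perm (Fin (n + 3))} (j : Fin (n + 2)) (h0 : α 0 = 0)
    (hj : α j.succ = j.succ) : ∃ σ, insertTwoFixed j σ = α := by
  obtain ⟨τ, rfl⟩ := exists_insertFixed_eq h0
  rw [← Fin.succAbove_zero, insertFixed_succAbove, Fin.succAbove_right_inj] at hj
  obtain ⟨σ, rfl⟩ := exists_insertFixed_eq hj
  exact ⟨σ, rfl⟩

lemma eq_zero_or_succ_or (j : Fin (n + 2)) (x : Fin (n + 3)) :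
    x = 0 ∨ x = j.succ ∨ ∃ y, x = (j.succAbove y).succ := by
  rcases Fin.eq_zero_or_eq_succ x with rfl | ⟨z, rfl⟩
  · exact .inl rfl
  · rcases Fin.eq_self_or_eq_succAbove j z with rfl | ⟨y, rfl⟩
    · exact .inr (.inl rfl)
    · exact .inr (.inr ⟨y, rfl⟩)

/-- Multiplying by a transposition of fixed points adds a two-cycle. -/
lemma cycleType_swap_mul {N : ℕ} {x y : Fin N} (hxy : x ≠ y) {σ : Perm (Fin N)} (hx : σ x = x)
    (hy : σ y = y) : (swap x y * σ).cycleType = {2} + σ.cycleType := by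
  rw [Disjoint.cycleType_mul, (isCycle_swap hxy).cycleType, card_support_swap hxy]
  intro z
  by_cases hz : σ z = z
  · exact .inr hz
  · refine .inl (swap_apply_of_ne_of_ne ?_ ?_) <;> rintro rfl
    exacts [hz hx, hz hy]

/-- Add a two-cycle through a new first point, placing the other new point right before the image
of the last point. -/
def insertPair (α : Perm (Fin (n + 1))) : Perm (Fin (n + 3)) :=
  swap 0 (α (Fin.last n)).castSucc.succ * insertTwoFixed (α (Fin.last n)).castSucc α

lemma cycleType_insertPair (α : Perm (Fin (n + 1))) :
    (insertPair α).cycleType = {2} + α.cycleType := by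
  rw [insertPair, cycleType_swap_mul (Fin.succ_ne_zero _).symm (by simp) (by simp),
    cycleType_insertTwoFixed]

lemma insertPair_zero (α : Perm (Fin (n + 1))) :
    insertPair α 0 = (α (Fin.last n)).castSucc.succ := by
  simp [insertPair]

lemma insertPair_succ (α : Perm (Fin (n + 1))) :
    insertPair α (α (Fin.last n)).castSucc.succ = 0 := by
  simp [insertPair]

lemma insertPair_succ_succAbove (α : Perm (Fin (n + 1))) (y : Fin (n + 1)) :
    insertPair α ((α (Fin.last n)).castSucc.succAbove y).succ =
      ((α (Fin.last n)).castSucc.succAbove (α y)).succ := by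
  rw [insertPair, mul_apply, insertTwoFixed_succ_succAbove, swap_apply_of_ne_of_ne]
  · exact Fin.succ_ne_zero _
  · simp [Fin.succAbove_ne]

lemma insertPair_injective : Function.Injective (insertPair (n := n)) := by
  intro α α' h
  have h0 : α (Fin.last n) = α' (Fin.last n) := by
    have := Equiv.congr_fun h 0
    rwa [insertPair_zero, insertPair_zero, Fin.succ_inj, Fin.castSucc_inj] at this
  rw [insertPair, insertPair, h0, mul_right_inj] at h
  exact insertFixed_injective _ (insertFixed_injective _ h)

lemma insertPair_inv_mul_finRotate {α : Perm (Fin (n + 1))}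
    (h : (α⁻¹ * finRotate (n + 1)) (Fin.last n) ≠ Fin.last n) :
    (insertPair α)⁻¹ * finRotate (n + 3) =
      swap (Fin.last (n + 2)) (α (Fin.last n)).castSucc.succ *
        (swap (Fin.last (n + 2)) 0 * insertTwoFixed (α (Fin.last n)).castSucc
          (α⁻¹ * finRotate (n + 1)) * (swap (Fin.last (n + 2)) 0)⁻¹) := by
  set β := α⁻¹ * finRotate (n + 1) with hβ
  set m := α (Fin.last n) with hm
  have hζ : ∀ y, finRotate (n + 1) y = α (β y) := fun y => by simp [hβ]
  have m0 : m ≠ 0 := by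
    rintro h0
    refine h (α.injective ?_)
    rw [← hζ, ← hm, h0, finRotate_last]
  have hlast : (m.castSucc.succAbove (Fin.last n)).succ = Fin.last (n + 2) := by
    rw [Fin.succAbove_of_le_castSucc _ _ (by simpa using Fin.le_last m)]
    rfl
  have hz : ∀ y, y ≠ Fin.last n → (m.castSucc.succAbove y).succ ≠ Fin.last (n + 2) := by
    intro y hy
    rw [← hlast, Ne, Fin.succ_inj, Fin.succAbove_right_inj]
    exact hy
  have jl : m.castSucc.succ ≠ Fin.last (n + 2) := by
    rw [← hlast, Ne, Fin.succ_inj]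
    exact (Fin.succAbove_ne _ _).symm
  have El : ∀ y, (m.castSucc.succAbove y).succ ≠ m.castSucc.succ := by
    intro y
    rw [Ne, Fin.succ_inj]
    exact Fin.succAbove_ne _ _
  rw [inv_mul_eq_iff_eq_mul]
  refine Equiv.ext fun x => ?_
  rw [swap_inv, mul_apply, mul_apply, mul_apply, mul_apply]
  have l0 : Fin.last (n + 2) ≠ 0 := Fin.last_pos.ne'
  rcases eq_zero_or_succ_or m.castSucc x with rfl | rfl | ⟨y, rfl⟩
  · rw [swap_apply_right, ← hlast, insertTwoFixed_succ_succAbove, hlast,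
      swap_apply_of_ne_of_ne (hz _ h) (Fin.succ_ne_zero _),
      swap_apply_of_ne_of_ne (hz _ h) (El _), insertPair_succ_succAbove, ← hζ]
    rw [finRotate_last, Fin.succAbove_of_castSucc_lt _ _ (by simpa using Fin.pos_iff_ne_zero.2 m0),
      Fin.ext_iff, val_finRotate]
    simp
  · rw [swap_apply_of_ne_of_ne jl (Fin.succ_ne_zero _), insertTwoFixed_succ,
      swap_apply_of_ne_of_ne jl (Fin.succ_ne_zero _), swap_apply_right]
    rw [← hlast, insertPair_succ_succAbove, ← hm, Fin.ext_iff]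
    have := m.2
    simp only [val_finRotate, Fin.val_succ, val_succAbove, Fin.val_castSucc]
    split_ifs <;> omega
  · by_cases hy : y = Fin.last n
    · rw [hy, hlast, swap_apply_left, insertTwoFixed_zero, swap_apply_right, swap_apply_left,
        insertPair_succ, finRotate_last]
    rw [swap_apply_of_ne_of_ne (hz y hy) (Fin.succ_ne_zero _), insertTwoFixed_succ_succAbove]
    have hy' : (y : ℕ) ≠ n := fun h' => hy (Fin.ext h')
    by_cases hb : β y = Fin.last n
    · have h1 := hζ y
      rw [hb, ← hm, Fin.ext_iff, val_finRotate] at h1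
      rw [hb, hlast, swap_apply_left, swap_apply_of_ne_of_ne l0.symm (Fin.succ_ne_zero _).symm,
        insertPair_zero, Fin.ext_iff]
      simp only [val_finRotate, Fin.val_succ, val_succAbove, Fin.val_castSucc] at h1 ⊢
      split_ifs at h1 ⊢ <;> omega
    · rw [swap_apply_of_ne_of_ne (hz _ hb) (Fin.succ_ne_zero _),
        swap_apply_of_ne_of_ne (hz _ hb) (El _), insertPair_succ_succAbove, ← hζ]
      have h1 : finRotate (n + 1) y ≠ m := by
        rw [hζ, hm]
        exact fun h' => hb (α.injective h')
      rw [Ne, Fin.ext_iff, val_finRotate] at h1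
      rw [Fin.ext_iff]
      simp only [val_finRotate, Fin.val_succ, val_succAbove, Fin.val_castSucc] at h1 ⊢
      split_ifs at h1 ⊢ <;> omega

lemma cycleType_insertPair_inv_mul {α : Perm (Fin (n + 1))}
    (h : (α⁻¹ * finRotate (n + 1)) (Fin.last n) ≠ Fin.last n) :
    ((insertPair α)⁻¹ * finRotate (n + 3)).cycleType =
      {2} + (α⁻¹ * finRotate (n + 1)).cycleType := by
  have jl : (α (Fin.last n)).castSucc.succ ≠ Fin.last (n + 2) := by
    rw [← Fin.succ_last, Ne, Fin.succ_inj]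
    exact (Fin.castSucc_lt_last _).ne
  rw [insertPair_inv_mul_finRotate h, cycleType_swap_mul jl.symm, cycleType_conj,
    cycleType_insertTwoFixed]
  · simp
  · have := swap_apply_of_ne_of_ne jl (Fin.succ_ne_zero _)
    rw [swap_inv, mul_apply, mul_apply, this, insertTwoFixed_succ, this]

lemma exists_insertPair_eq {α : Perm (Fin (n + 3))} {j : Fin (n + 1)} (h0 : α 0 = j.castSucc.succ)
    (hj : α j.castSucc.succ = 0) (hl : α (Fin.last (n + 2)) = finRotate (n + 3) j.castSucc.succ) :
    ∃ σ, insertPair σ = α := by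
  obtain ⟨σ, hσ⟩ := exists_insertTwoFixed_eq (α := swap 0 j.castSucc.succ * α) j.castSucc
    (by simp [h0]) (by simp [hj])
  have h1 : σ (Fin.last n) = j := by
    have hlast : (j.castSucc.succAbove (Fin.last n)).succ = Fin.last (n + 2) := by
      rw [Fin.succAbove_of_le_castSucc _ _ (by simpa using Fin.le_last j)]
      rfl
    have h2 := Equiv.congr_fun hσ (Fin.last (n + 2))
    have h3 : finRotate (n + 3) j.castSucc.succ = (j.castSucc.succAbove j).succ := by
      rw [Fin.ext_iff]
      have := j.2
      simp only [val_finRotate, Fin.val_succ, val_succAbove, Fin.val_castSucc]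
      split_ifs <;> omega
    rw [mul_apply, hl, ← hlast, insertTwoFixed_succ_succAbove, h3, swap_apply_of_ne_of_ne
      (Fin.succ_ne_zero _), Fin.succ_inj, Fin.succAbove_right_inj] at h2
    · exact h2
    · rw [Ne, Fin.succ_inj]
      exact Fin.succAbove_ne _ _
  exact ⟨σ, by rw [insertPair, h1, hσ, swap_mul_self_mul]⟩

end insertPair

section count

lemma apply_ne_of_mem_pairings {μ : Multiset ℕ} {a r n : ℕ} {α : Perm (Fin n)}
    (h : α ∈ pairings μ a r n) (hμ : μ.sum + r * 2 = n) (i : Fin n) :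
    (α⁻¹ * finRotate n) i ≠ i := by
  rw [pairings, Finset.mem_filter] at h
  revert i
  rw [← sum_cycleType_eq_iff, h.2.2, ← hμ]
  simp

lemma card_filter_pairings {μ : Multiset ℕ} {a r n : ℕ} (ha : a * 2 = n + 1)
    (hμ : μ.sum + r * 2 = n + 1) :
    ((pairings μ (a + 1) (r + 1) (n + 3)).filter fun α =>
      (α⁻¹ * finRotate (n + 3)) ((α⁻¹ * finRotate (n + 3)) (Fin.last (n + 2))) =
        Fin.last (n + 2)).card = (pairings μ a r (n + 1)).card := by
  symm
  refine Finset.card_bij (fun α _ => insertPair α) (fun α hα => ?_)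
    (fun α _ α' _ h => insertPair_injective h) fun α hα => ?_
  · have hl := apply_ne_of_mem_pairings hα hμ (Fin.last n)
    rw [pairings, Finset.mem_filter] at hα
    rw [pairings, Finset.mem_filter, Finset.mem_filter, cycleType_insertPair,
      cycleType_insertPair_inv_mul hl, hα.2.1, hα.2.2]
    refine ⟨⟨Finset.mem_univ _, ?_, ?_⟩, ?_⟩
    · rw [Multiset.replicate_succ]; rfl
    · rw [Multiset.replicate_succ, add_left_comm]; rfl
    · simp only [mul_apply, finRotate_last]
      rw [inv_eq_iff_eq (f := insertPair α) (x := 0) |>.2 (insertPair_succ α).symm]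
      have hlast : ((α (Fin.last n)).castSucc.succAbove (Fin.last n)).succ = Fin.last (n + 2) := by
        rw [Fin.succAbove_of_le_castSucc _ _ (by simpa using Fin.le_last _)]
        rfl
      rw [inv_eq_iff_eq, ← hlast, insertPair_succ_succAbove, Fin.ext_iff]
      have := (α (Fin.last n)).2
      simp only [val_finRotate, Fin.val_succ, val_succAbove, Fin.val_castSucc]
      split_ifs <;> omega
  · obtain ⟨hα, hl⟩ := Finset.mem_filter.1 hα
    have hβ := apply_ne_of_mem_pairings hα (by omega)
    rw [pairings, Finset.mem_filter] at hα
    have f1 := (sum_cycleType_eq_iff α).1 (by rw [hα.2.1]; simp; omega)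
    have hi : α ^ 2 = 1 := pow_prime_eq_one_iff.2 fun c hc => by
      rw [hα.2.1] at hc
      exact Multiset.eq_of_mem_replicate hc
    have hinv : α⁻¹ = α := by rw [inv_eq_iff_mul_eq_one, ← pow_two, hi]
    have hii : ∀ x, α (α x) = x := fun x => by rw [← mul_apply, ← pow_two, hi, one_apply]
    rw [mul_apply, inv_eq_iff_eq, mul_apply, finRotate_last, hinv] at hl
    obtain ⟨k, hk⟩ : ∃ k : Fin (n + 2), α 0 = k.succ := ⟨_, (Fin.succ_pred _ (f1 0)).symm⟩
    obtain ⟨j, rfl⟩ : ∃ j : Fin (n + 1), k = j.castSucc := by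
      refine ⟨k.castPred ?_, (Fin.castSucc_castPred _ _).symm⟩
      rintro rfl
      refine hβ (Fin.last _) ?_
      rw [mul_apply, finRotate_last, hinv, hk, Fin.succ_last]
    obtain ⟨σ, rfl⟩ := exists_insertPair_eq hk (by rw [← hk, hii]) (by rw [← hl, hk])
    have hs : σ (Fin.last n) = j := by
      rwa [insertPair_zero, Fin.succ_inj, Fin.castSucc_inj] at hk
    have hσ : (σ⁻¹ * finRotate (n + 1)) (Fin.last n) ≠ Fin.last n := by
      rw [inv_mul_finRotate_ne_iff, hs, finRotate_last]
      rintro rfl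
      refine hβ 0 ?_
      have : finRotate (n + 3) 0 = (Fin.castSucc (0 : Fin (n + 1))).succ := by
        rw [Fin.ext_iff, val_finRotate]
        simp
      rw [mul_apply, hinv, this, ← hk, hii]
    rw [cycleType_insertPair, cycleType_insertPair_inv_mul hσ] at hα
    refine ⟨σ, ?_, rfl⟩
    rw [pairings, Finset.mem_filter]
    refine ⟨Finset.mem_univ _, ?_, ?_⟩
    · have := hα.2.1
      rw [Multiset.replicate_succ] at this
      exact Multiset.cons_inj_right 2 |>.1 this
    · have := hα.2.2
      rw [Multiset.replicate_succ, ← Multiset.singleton_add, add_left_comm] at this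
      exact add_left_cancel this

end count

section pairings

lemma card_pairings_succ {μ : Multiset ℕ} {a r n : ℕ} (hμ2 : 2 ∉ μ) (ha : a * 2 = n + 1)
    (hμ : μ.sum + r * 2 = n + 1) :
    2 * (r + 1) * (pairings μ (a + 1) (r + 1) (n + 3)).card =
      (n + 3) * (pairings μ a r (n + 1)).card := by
  rw [two_mul_card_pairings hμ2 (by omega) (Fin.last _), card_filter_pairings ha hμ]

lemma mem_pairings_zero {μ : Multiset ℕ} {a n : ℕ} (hn : n = a * 2) (α : Perm (Fin n)) :
    α ∈ pairings μ a 0 n ↔ (α * α = 1 ∧ ∀ i, α i ≠ i) ∧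
      (α⁻¹ * finRotate n).cycleType = μ := by
  rw [pairings, Finset.mem_filter, Multiset.replicate_zero, add_zero]
  refine ⟨fun h => ⟨⟨?_, ?_⟩, h.2.2⟩, fun h => ⟨Finset.mem_univ _, ?_, h.2⟩⟩
  · rw [← pow_two]
    refine pow_prime_eq_one_iff.2 fun c hc => ?_
    rw [h.2.1] at hc
    exact Multiset.eq_of_mem_replicate hc
  · exact (sum_cycleType_eq_iff α).1 (by rw [h.2.1]; simp; omega)
  · exact cycleType_eq_replicate_of_pow (by rw [pow_two, h.1.1]) h.1.2 hn

lemma card_pairings_four_zero : (pairings {4} 2 0 4).card = 1 := by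
  rw [Finset.card_eq_one]
  refine ⟨finRotate 4 ^ 2, Finset.ext fun α => ?_⟩
  rw [mem_pairings_zero rfl, Finset.mem_singleton]
  constructor
  · rintro ⟨h, h4⟩
    have h0 := (sum_cycleType_eq_iff (α⁻¹ * finRotate 4)).1 (by rw [h4]; rfl)
    simp only [inv_mul_finRotate_ne_iff] at h0
    clear h4
    revert α
    decide
  · rintro rfl
    refine ⟨by decide, ?_⟩
    rw [show (finRotate 4 ^ 2)⁻¹ * finRotate 4 = (finRotate 4)⁻¹ by decide, cycleType_inv,
      cycleType_finRotate]

lemma card_pairings_three_three_zero : (pairings {3, 3} 3 0 6).card = 1 := by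
  rw [Finset.card_eq_one]
  refine ⟨finRotate 6 ^ 3, Finset.ext fun α => ?_⟩
  rw [mem_pairings_zero rfl, Finset.mem_singleton]
  constructor
  · rintro ⟨⟨h, h1⟩, h4⟩
    have h0 := (sum_cycleType_eq_iff (α⁻¹ * finRotate 6)).1 (by rw [h4]; rfl)
    have h3 := (pow_prime_eq_one_iff (p := 3) (σ := α⁻¹ * finRotate 6)).2 (by rw [h4]; simp)
    simp only [inv_mul_finRotate_ne_iff] at h0
    clear h4
    revert α
    decide +kernel
  · rintro rfl
    refine ⟨by decide +kernel, ?_⟩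
    rw [cycleType_eq_replicate_of_pow (p := 3) (a := 2) (by decide +kernel) (by decide +kernel) rfl]
    rfl

end pairings

section core

lemma card_pairings_four (r : ℕ) :
    (pairings {4} (r + 2) r (2 * (r + 2))).card = (r + 2).choose 2 := by
  induction r with
  | zero => exact card_pairings_four_zero
  | succ r ih =>
    have h := card_pairings_succ (μ := {4}) (a := r + 2) (r := r) (n := 2 * r + 3) (by decide)
      (by ring) (by simp; ring)
    rw [show 2 * (r + 1 + 2) = 2 * r + 3 + 3 by ring]
    rw [show 2 * r + 3 + 1 = 2 * (r + 2) by ring, ih] at h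
    have h1 := Nat.choose_mul_succ_eq (r + 2) 2
    rw [show r + 2 + 1 - 2 = r + 1 by omega] at h1
    refine Nat.eq_of_mul_eq_mul_left (n := 2 * (r + 1)) (by omega) (h.trans ?_)
    linarith

lemma card_pairings_three_three (r : ℕ) :
    (pairings {3, 3} (r + 3) r (2 * (r + 3))).card = (r + 3).choose 3 := by
  induction r with
  | zero => exact card_pairings_three_three_zero
  | succ r ih =>
    have h := card_pairings_succ (μ := {3, 3}) (a := r + 3) (r := r) (n := 2 * r + 5) (by decide)
      (by ring) (by simp; ring)
    rw [show 2 * (r + 1 + 3) = 2 * r + 5 + 3 by ring]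
    rw [show 2 * r + 5 + 1 = 2 * (r + 3) by ring, ih] at h
    have h1 := Nat.choose_mul_succ_eq (r + 3) 3
    rw [show r + 3 + 1 - 3 = r + 1 by omega] at h1
    refine Nat.eq_of_mul_eq_mul_left (n := 2 * (r + 1)) (by omega) (h.trans ?_)
    linarith

open Classical in
lemma card_core (s : ℕ) :
    (Finset.univ.filter fun α : Perm (Fin (2 * s)) =>
      IsGenusOnePartition α ∧ ∀ i, α i ≠ i ∧ α i ≠ finRotate (2 * s) i).card =
        (s + 1).choose 3 := by
  simp only [isGenusOnePartition_and_iff]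
  rcases s with _ | _ | _ | s
  · simp [Nat.choose]
  · simp
  · refine (congrArg Finset.card (Finset.ext fun α => ?_)).trans card_pairings_four_zero
    simp
  · have h : (Finset.univ.filter fun α : Perm (Fin (2 * (s + 3))) =>
        (∃ r, s + 3 = r + 2 ∧ α ∈ pairings {4} (s + 3) r (2 * (s + 3))) ∨
          ∃ r, s + 3 = r + 3 ∧ α ∈ pairings {3, 3} (s + 3) r (2 * (s + 3))) =
        pairings {4} (s + 1 + 2) (s + 1) (2 * (s + 1 + 2)) ∪
          pairings {3, 3} (s + 3) s (2 * (s + 3)) := by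
      ext α
      rw [Finset.mem_filter, Finset.mem_union]
      refine ⟨fun h => h.2.imp ?_ ?_, fun h => ⟨Finset.mem_univ _, h.imp (fun h => ⟨s + 1, rfl, h⟩)
        fun h => ⟨s, rfl, h⟩⟩⟩ <;>
      · rintro ⟨r, hr, h⟩
        obtain rfl : r = _ := by simpa using hr.symm
        exact h
    rw [h, Finset.card_union_of_disjoint, card_pairings_four, card_pairings_three_three,
      Nat.choose_succ_succ' (s + 3) 2]
    rw [Finset.disjoint_left]
    intro α h4 h3
    rw [pairings, Finset.mem_filter] at h3 h4
    have := congrArg (Multiset.count 4) (h4.2.2.symm.trans h3.2.2)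
    simp [Multiset.count_replicate] at this

lemma coreSum_two_mul {R : Type*} [CommRing R] (b w : R) (s : ℕ) :
    coreSum b w (2 * s) = (s + 1).choose 3 * (b * w) ^ s := by
  classical
  rw [coreSum, ← Finset.sum_filter, Finset.sum_congr rfl (g := fun _ => (b * w) ^ s),
    Finset.sum_const, nsmul_eq_mul, ← card_core]
  intro α hα
  obtain ⟨h1, h2⟩ := core_eq_two_mul (Finset.mem_filter.1 hα).2.1 (Finset.mem_filter.1 hα).2.2
  rw [cycleWeight, h2, ← mul_pow, ← Nat.eq_of_mul_eq_mul_left two_pos h1]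

lemma coreSum_of_odd {R : Type*} [CommRing R] (b w : R) {n : ℕ} (hn : Odd n) :
    coreSum b w n = 0 := by
  refine Finset.sum_eq_zero fun α _ => if_neg fun h => ?_
  have := (core_eq_two_mul h.1 h.2).1
  exact Nat.not_even_iff_odd.2 hn (this ▸ even_two_mul _)

end core

section binomial

lemma cast_choose_mul_sub {n k : ℕ} :
    ((n + 1).choose k : ℚ) * (n + 1 - k) = (n + 1) * n.choose k := by
  rcases le_or_gt k (n + 1) with h | h
  · have := Nat.choose_mul_succ_eq n k
    zify [h] at this
    qify at this
    linarith
  · rw [Nat.choose_eq_zero_of_lt h, Nat.choose_eq_zero_of_lt (by omega)]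
    simp

lemma cast_choose_succ_mul {n k : ℕ} :
    (n.choose (k + 1) : ℚ) * (k + 1) = n.choose k * (n - k) := by
  rcases le_or_gt k n with h | h
  · have := Nat.choose_succ_right_eq n k
    zify [h] at this
    qify at this
    exact this
  · rw [Nat.choose_eq_zero_of_lt h, Nat.choose_eq_zero_of_lt (by omega)]
    simp

lemma sum_cube_sub_mul_choose_mul_choose (n k : ℕ) :
    ∑ s ∈ Finset.range (k + 3),
      ((s : ℚ) ^ 3 - s) * ((n + 2).choose (k + 2 - s) * (n + 2).choose (k + 2 + s)) =
      (n + 2).choose 2 * n.choose (k + 2) * n.choose k := by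
  set t : ℕ → ℚ := fun s => (n + 2).choose (k + 2 - s) * (n + 2).choose (k + 2 + s) with ht
  set K : ℚ := k + 2 with hK
  set L : ℚ := n - k with hL
  let g : ℕ → ℚ := fun s => s * (s - 1) / (2 * (n + 1)) + (K * L / (n + 1) - 1) / (2 * (n + 2))
  have hn1 : (n + 1 : ℚ) ≠ 0 := by positivity
  have hn2 : (n + 2 : ℚ) ≠ 0 := by positivity
  have hrec : ∀ s : ℕ, ((s : ℚ) ^ 3 - s) * t s =
      g s * (K + s) * (L + s) * t s - g (s + 1) * (K - s) * (L - s) * t s := by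
    intro s
    have : (s : ℚ) ^ 3 - s = g s * (K + s) * (L + s) - g (s + 1) * (K - s) * (L - s) := by
      simp only [g, hK, hL]
      field_simp
      push_cast
      ring
    rw [this]
    ring
  have hstep : ∀ s, s < k + 2 →
      (K - s) * (L - s) * t s = (K + (s + 1 : ℕ)) * (L + (s + 1 : ℕ)) * t (s + 1) := by
    intro s hs
    obtain ⟨d, hd⟩ : ∃ d, k + 2 = s + d + 1 := ⟨k + 1 - s, by omega⟩
    have h1 := cast_choose_succ_mul (n := n + 2) (k := d)
    have h2 := cast_choose_succ_mul (n := n + 2) (k := k + 2 + s)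
    have hd' : (k : ℚ) + 2 = s + d + 1 := by exact_mod_cast hd
    simp only [ht, show k + 2 - s = d + 1 by omega, show k + 2 - (s + 1) = d by omega,
      ← add_assoc]
    push_cast at h1 h2 ⊢
    have e1 : K - s = d + 1 := by rw [hK]; linarith
    have e2 : L + (s + 1) = n + 2 - d := by rw [hL]; linarith
    have e3 : L - s = n + 2 - (k + 2 + s) := by rw [hL]; ring
    have e4 : K + (s + 1) = k + 2 + s + 1 := by rw [hK]; ring
    rw [e1, e2, e3, e4]
    linear_combination (n + 2 - (k + 2 + s) : ℚ) * ((n + 2).choose (k + 2 + s)) * h1 -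
      (n + 2 - d : ℚ) * ((n + 2).choose d) * h2
  have hsum : ∀ m, m ≤ k + 2 → ∑ s ∈ Finset.range m, ((s : ℚ) ^ 3 - s) * t s =
      g 0 * K * L * t 0 - g m * (K + m) * (L + m) * t m := by
    intro m
    induction m with
    | zero => simp
    | succ m ih =>
      intro hm
      rw [Finset.sum_range_succ, ih (by omega), hrec]
      linear_combination -g (m + 1) * hstep m (by omega)
  have hlast := hrec (k + 2)
  rw [show K - (k + 2 : ℕ) = 0 by rw [hK]; push_cast; ring] at hlast
  rw [Finset.sum_range_succ, hsum _ le_rfl, hlast]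
  have ht0 : t 0 = (n + 2).choose (k + 2) * (n + 2).choose (k + 2) := by simp [ht]
  have c1 : ((n + 2).choose (k + 2) : ℚ) * (L * (L - 1)) =
      (n + 2) * (n + 1) * n.choose (k + 2) := by
    have h1 := cast_choose_mul_sub (n := n + 1) (k := k + 2)
    have h2 := cast_choose_mul_sub (n := n) (k := k + 2)
    push_cast at h1 h2
    rw [hL]
    linear_combination (n - k - 1 : ℚ) * h1 + (n + 2 : ℚ) * h2
  have c2 : ((n + 2).choose (k + 2) : ℚ) * (K * (K - 1)) = (n + 2) * (n + 1) * n.choose k := by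
    have h1 := Nat.add_one_mul_choose_eq (n + 1) (k + 1)
    have h2 := Nat.add_one_mul_choose_eq n k
    qify at h1 h2
    rw [hK]
    linear_combination -(k + 1 : ℚ) * h1 - (n + 2 : ℚ) * h2
  have c3 : ((n + 2).choose 2 : ℚ) = (n + 2) * (n + 1) / 2 := by
    rw [Nat.cast_choose_two]
    push_cast
    ring
  have g0 : g 0 = (K - 1) * (L - 1) / (2 * (n + 2) * (n + 1)) := by
    simp only [g, hK, hL]
    field_simp
    push_cast
    ring
  rw [ht0, c3, g0]
  have e : (n.choose (k + 2) : ℚ) * n.choose k =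
      ((n + 2).choose (k + 2) * (L * (L - 1))) * ((n + 2).choose (k + 2) * (K * (K - 1))) /
        ((n + 2) * (n + 1)) ^ 2 := by
    rw [c1, c2]
    field_simp
  rw [mul_assoc ((n + 2 : ℚ) * (n + 1) / 2), e]
  field_simp
  ring

end binomial

section extraction

open Polynomial

/-- The bivariate polynomials without terms of total degree `m`. -/
def vanishingDegree (m : ℕ) : AddSubgroup ℤ[X][X] where
  carrier := {P | ∀ i j, i + j = m → (P.coeff j).coeff i = 0}
  zero_mem' := by simp
  add_mem' hP hQ i j h := by simp [hP i j h, hQ i j h]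
  neg_mem' hP i j h := by simp [hP i j h]

lemma C_X_mul_mem_vanishingDegree {m : ℕ} {P : ℤ[X][X]} (hP : P ∈ vanishingDegree m) :
    C X * P ∈ vanishingDegree (m + 1) := by
  rintro (_ | i) j h
  · simp
  · rw [coeff_C_mul, coeff_X_mul]
    exact hP i j (by omega)

lemma X_mul_mem_vanishingDegree {m : ℕ} {P : ℤ[X][X]} (hP : P ∈ vanishingDegree m) :
    X * P ∈ vanishingDegree (m + 1) := by
  rintro i (_ | j) h
  · simp
  · rw [coeff_X_mul]
    exact hP i j (by omega)

lemma prod_mul_mem_vanishingDegree {ι : Type*} (s : Finset ι) (f : ι → Fin 3) {m : ℕ}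
    {P : ℤ[X][X]} (hP : P ∈ vanishingDegree m) :
    (∏ i ∈ s, ![1, -(C X : ℤ[X][X]), -X] (f i)) * P ∈
      vanishingDegree (m + (s.filter fun i => f i ≠ 0).card) := by
  classical
  induction s using Finset.induction_on with
  | empty => simpa using hP
  | insert a s ha ih =>
    rw [Finset.prod_insert ha, Finset.filter_insert, mul_assoc]
    have h : f a = 0 ∨ f a = 1 ∨ f a = 2 := by omega
    rcases h with h | h | h
    · rw [if_neg (by simp [h]), h]
      exact (one_mul (_ : ℤ[X][X])).symm ▸ ih
    · rw [if_pos (by simp [h]), Finset.card_insert_of_notMem (by simp [ha]), h]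
      exact (neg_mul (C X : ℤ[X][X]) _).symm ▸ neg_mem (C_X_mul_mem_vanishingDegree ih)
    · rw [if_pos (by simp [h]), Finset.card_insert_of_notMem (by simp [ha]), h]
      exact (neg_mul (X : ℤ[X][X]) _).symm ▸ neg_mem (X_mul_mem_vanishingDegree ih)

lemma coeff_coeff_C_mul_map (p q : ℤ[X]) (i j : ℕ) :
    ((C p * q.map C).coeff j).coeff i = p.coeff i * q.coeff j := by
  rw [coeff_C_mul, coeff_map, coeff_mul_C]

lemma coeff_coeff_pow (i j s : ℕ) :
    (((C X * X : ℤ[X][X]) ^ s).coeff j).coeff i = if i = s ∧ j = s then 1 else 0 := by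
  have : (C X * X : ℤ[X][X]) ^ s = C (X ^ s) * (X ^ s : ℤ[X]).map C := by simp [mul_pow]
  rw [this, coeff_coeff_C_mul_map, coeff_X_pow, coeff_X_pow]
  split_ifs <;> simp_all

/-- The truncated generating function of the tetrahedral numbers. -/
noncomputable def tetrahedralSum (N : ℕ) : ℤ[X][X] :=
  ∑ s ∈ Finset.range (N + 1), ((s + 1).choose 3 : ℤ[X][X]) * (C X * X) ^ s

lemma natCast_mul_pow_mem_vanishingDegree {m s : ℕ} (h : m ≠ 2 * s) (c : ℕ) :
    (c : ℤ[X][X]) * (C X * X) ^ s ∈ vanishingDegree m := by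
  rw [← nsmul_eq_mul]
  refine nsmul_mem (fun i j hij => ?_) c
  rw [coeff_coeff_pow, if_neg]
  omega

lemma coreSum_sub_tetrahedralSum_mem {n N : ℕ} (h : n ≤ N) :
    coreSum (C X : ℤ[X][X]) X n - tetrahedralSum N ∈ vanishingDegree n := by
  rw [← neg_mem_iff, neg_sub, tetrahedralSum]
  rcases Nat.even_or_odd n with hn | hn
  · obtain ⟨s, rfl⟩ := even_iff_exists_two_mul.1 hn
    rw [coreSum_two_mul, ← Finset.sum_erase_eq_sub (Finset.mem_range.2 (by omega))]
    refine sum_mem fun t ht => natCast_mul_pow_mem_vanishingDegree ?_ _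
    have := Finset.ne_of_mem_erase ht
    omega
  · rw [coreSum_of_odd _ _ hn, sub_zero]
    refine sum_mem fun t ht => natCast_mul_pow_mem_vanishingDegree ?_ _
    rintro rfl
    exact Nat.not_odd_iff_even.2 (even_two_mul t) hn

lemma pow_mul_mem_vanishingDegree {n : ℕ} (hn : 1 ≤ n) (P : ℤ[X][X]) :
    (C X * X : ℤ[X][X]) ^ n * P ∈ vanishingDegree n := by
  intro i j hij
  rw [mul_pow, ← C_pow, mul_assoc, coeff_C_mul, coeff_X_pow_mul', coeff_X_pow_mul']
  split_ifs with h1 h2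
  · omega
  · simp
  · rfl

lemma genusOneSum_sub_mem {n N : ℕ} (h : n ≤ N) :
    genusOneSum (C X : ℤ[X][X]) X n - ((1 + C X : ℤ[X][X]) * (1 + X)) ^ n * tetrahedralSum N ∈
      vanishingDegree n := by
  induction n using Nat.strong_induction_on with
  | _ n ih =>
  rcases lt_or_ge n 2 with hn | hn
  · rw [genusOneSum_of_lt _ _ hn, zero_sub, neg_mem_iff, tetrahedralSum, Finset.mul_sum]
    refine sum_mem fun s _ i j hij => ?_
    rcases lt_or_ge s 2 with hs | hs
    · rw [Nat.choose_eq_zero_of_lt (by omega)]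
      simp
    · rw [mul_pow (C X : ℤ[X][X]), ← mul_assoc, ← mul_assoc, coeff_mul_X_pow',
        if_neg (by omega), coeff_zero]
  · have hz : ∀ f : Fin n → Fin 3, ∏ i, letterWeight (C X : ℤ[X][X]) X (f i) =
        (∏ i, ![1, -(C X : ℤ[X][X]), -X] (f i)) *
          ((1 + C X : ℤ[X][X]) * (1 + X : ℤ[X][X])) ^
            (Finset.univ.filter fun i => f i = 0).card := by
      intro f
      rw [← Finset.prod_const, Finset.prod_filter, ← Finset.prod_mul_distrib]
      refine Finset.prod_congr rfl fun i _ => ?_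
      generalize f i = c
      fin_cases c <;> simp [letterWeight]
    set D : (Fin n → Fin 3) → ℤ[X][X] := fun f => if Admissible f then
      (∏ i, ![1, -(C X : ℤ[X][X]), -X] (f i)) *
        (genusOneSum (C X : ℤ[X][X]) X (Finset.univ.filter fun i => f i = 0).card -
          ((1 + C X : ℤ[X][X]) * (1 + X)) ^ (Finset.univ.filter fun i => f i = 0).card *
            tetrahedralSum N)
      else 0 with hD
    have hsum : ∑ f, D f = coreSum (C X : ℤ[X][X]) X n - tetrahedralSum N -
        (C X * X : ℤ[X][X]) ^ n * tetrahedralSum N := by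
      rw [coreSum_eq _ _ hn, sub_sub, ← one_add_mul, ← sum_admissible _ _ (by omega : 1 ≤ n),
        Finset.sum_mul, ← Finset.sum_sub_distrib]
      refine Finset.sum_congr rfl fun f _ => ?_
      rw [hz]
      simp only [hD]
      split_ifs <;> ring
    have h0 : Admissible (0 : Fin n → Fin 3) := fun i => by simp
    have hD0 : D 0 = genusOneSum (C X : ℤ[X][X]) X n -
        ((1 + C X : ℤ[X][X]) * (1 + X)) ^ n * tetrahedralSum N := by
      simp only [hD]
      rw [if_pos h0]
      simp
    rw [← hD0, ← add_sub_cancel_right (D 0) (∑ f ∈ Finset.univ.erase 0, D f),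
      Finset.add_sum_erase _ _ (Finset.mem_univ _), hsum]
    refine sub_mem (sub_mem (coreSum_sub_tetrahedralSum_mem h)
      (pow_mul_mem_vanishingDegree (by omega) _)) (sum_mem fun f hf => ?_)
    simp only [hD]
    split_ifs
    · have hcard : (Finset.univ.filter fun i => f i = 0).card +
          (Finset.univ.filter fun i => f i ≠ 0).card = _ :=
        Finset.card_filter_add_card_filter_not (s := Finset.univ) fun i => f i = 0
      rw [Finset.card_univ, Fintype.card_fin] at hcard
      obtain ⟨t, ht⟩ := Function.ne_iff.1 (Finset.ne_of_mem_erase hf)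
      have hpos : 0 < (Finset.univ.filter fun i => f i ≠ 0).card :=
        Finset.card_pos.2 ⟨t, by simpa using ht⟩
      have := prod_mul_mem_vanishingDegree Finset.univ f
        (ih (Finset.univ.filter fun i => f i = 0).card (by omega) (by omega))
      rwa [hcard] at this
    · exact zero_mem _

open Classical in
lemma coeff_genusOneSum (n k : ℕ) :
    ((genusOneSum (C X : ℤ[X][X]) (X : ℤ[X][X]) n).coeff (n - k)).coeff k =
      (Finset.univ.filter fun α : Perm (Fin n) => IsGenusOnePartition α ∧ zPerm α = k).card := by
  rw [genusOneSum, finsetSum_coeff, finsetSum_coeff, Finset.card_filter, Nat.cast_sum]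
  refine Finset.sum_congr rfl fun α _ => ?_
  by_cases hα : IsGenusOnePartition α
  · have h : cycleWeight (C X : ℤ[X][X]) (X : ℤ[X][X]) α = C (X ^ zPerm α) *
        (X ^ (zPerm (α⁻¹ * finRotate n) + 1) : ℤ[X]).map C := by simp [cycleWeight]
    have := hα.1
    rw [if_pos hα, h, coeff_coeff_C_mul_map, coeff_X_pow, coeff_X_pow]
    by_cases hz : zPerm α = k
    · rw [if_pos hz.symm, if_pos (by omega), if_pos ⟨hα, hz⟩]
      simp
    · rw [if_neg (Ne.symm hz), if_neg fun h : _ ∧ _ => hz h.2]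
      simp
  · simp [hα]

lemma coeff_pow_mul_tetrahedralSum (n i j N : ℕ) :
    ((((1 + C X : ℤ[X][X]) * (1 + X : ℤ[X][X])) ^ n * tetrahedralSum N).coeff j).coeff i =
      ∑ s ∈ Finset.range (N + 1), ((s + 1).choose 3 : ℤ) *
        ((if s ≤ i then (n.choose (i - s) : ℤ) else 0) *
          if s ≤ j then (n.choose (j - s) : ℤ) else 0) := by
  rw [tetrahedralSum, Finset.mul_sum, finsetSum_coeff, finsetSum_coeff]
  refine Finset.sum_congr rfl fun s _ => ?_
  have h : ((1 + C X : ℤ[X][X]) * (1 + X : ℤ[X][X])) ^ n *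
      (((s + 1).choose 3 : ℤ[X][X]) * (C X * X) ^ s) =
      C (((s + 1).choose 3 : ℤ[X]) * ((1 + X) ^ n * X ^ s)) *
        ((1 + X) ^ n * X ^ s : ℤ[X]).map C := by
    simp [mul_pow]
    ring
  rw [h, coeff_coeff_C_mul_map, coeff_natCast_mul, coeff_mul_X_pow', coeff_mul_X_pow',
    coeff_one_add_X_pow, coeff_one_add_X_pow, mul_assoc]

open Classical in
lemma card_isGenusOnePartition {n k : ℕ} (hk : k ≤ n) :
    ((Finset.univ.filter fun α : Perm (Fin n) =>
      IsGenusOnePartition α ∧ zPerm α = k).card : ℤ) =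
      ∑ s ∈ Finset.range (k + 1), ((s + 1).choose 3 : ℤ) *
        (n.choose (k - s) * n.choose (k + s)) := by
  rw [← coeff_genusOneSum n k]
  have h := genusOneSum_sub_mem (le_refl n) k (n - k) (by omega)
  rw [coeff_sub, coeff_sub, sub_eq_zero] at h
  rw [h, coeff_pow_mul_tetrahedralSum]
  refine (Finset.sum_subset (Finset.range_mono (by omega)) fun s _ hs => ?_).symm.trans
    (Finset.sum_congr rfl fun s hs => ?_)
  · rw [if_neg (by simpa using hs)]
    simp
  · rw [if_pos (Nat.lt_succ_iff.1 (Finset.mem_range.1 hs))]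
    congr 2
    split_ifs with h1
    · rw [← Nat.choose_symm (by omega : n - k - s ≤ n), show n - (n - k - s) = k + s by omega]
    · rw [Nat.choose_eq_zero_of_lt (by omega : n < k + s), Nat.cast_zero]

end extraction

end genusOnePartitions

/-- For `n ≥ 2` and `k ≥ 2`, six times the number of genus-one set partitions of
`{1,…,n}` with exactly `k` blocks equals `C(n,2)·C(n−2,k)·C(n−2,k−2)`. -/
theorem genus_one_partition_count (n k : ℕ) (hn : 2 ≤ n) (hk : 2 ≤ k) :
    6 * Nat.card {α : Equiv.Perm (Fin n) // IsGenusOne α ∧ IsPartitionPerm α ∧ zPerm α = k} =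
      n.choose 2 * (n - 2).choose k * (n - 2).choose (k - 2) := by
  classical
  have hiff : ∀ α : Equiv.Perm (Fin n), (IsGenusOne α ∧ IsPartitionPerm α ∧ zPerm α = k) ↔
      (IsGenusOnePartition α ∧ zPerm α = k) := fun α => by
    rw [isPartitionPerm_iff, IsGenusOne, IsGenusOnePartition]
    omega
  rw [Nat.card_congr (Equiv.subtypeEquivRight hiff), Nat.card_eq_fintype_card, Fintype.card_subtype]
  rcases lt_or_ge n k with h | h
  · rw [Nat.choose_eq_zero_of_lt (by omega : n - 2 < k),
      Finset.filter_false_of_mem fun α _ hα => ?_]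
    · simp
    · have := hα.1.1
      omega
  · obtain ⟨n, rfl⟩ := Nat.exists_eq_add_of_le' hn
    obtain ⟨k, rfl⟩ := Nat.exists_eq_add_of_le' hk
    have h1 := card_isGenusOnePartition h
    have h2 := sum_cube_sub_mul_choose_mul_choose n k
    have h3 : ∀ s : ℕ, (6 * ((s + 1).choose 3 : ℕ) : ℚ) = (s : ℚ) ^ 3 - s := by
      intro s
      have h4 := cast_choose_succ_mul (n := s + 1) (k := 2)
      rw [Nat.cast_choose_two] at h4
      push_cast at h4
      linear_combination 2 * h4
    simp only [Nat.add_sub_cancel]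
    qify at h1 ⊢
    rw [h1, ← h2, Finset.mul_sum]
    refine Finset.sum_congr rfl fun s _ => ?_
    rw [← h3, mul_assoc]
end
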